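/- arXiv:2402.00240 — 11 statements merged into one kernel-verified Lean document; each statement's English description precedes it below -/
import Mathlib

section
/- Let p, q ≥ 1, let W ∈ ℂ^{p×q}, and let N be any norm on the space of q×q complex matrices. Then the sequence t ↦ ( N( (Wᴴ W)^{2^t} ) )^{2^{-(t+1)}} (indexed by natural numbers t ≥ 0) converges to σ₁(W) as t → ∞. -/
open Matrix

/-- The spectral norm (largest singular value) of a complex matrix, i.e. the operator norm
of the associated linear map between Euclidean spaces. -/
noncomputable def sigma1 {m n : Type*} [Fintype m] [Fintype n] [DecidableEq n]
    (A : Matrix m n ℂ) : ℝ :=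
  ‖LinearMap.toContinuousLinearMap (Matrix.toEuclideanLin A)‖

theorem gram_aux_bound {E F : Type*} [NormedAddCommGroup E] [NormedSpace ℂ E]
    [NormedAddCommGroup F] [NormedSpace ℂ F] [FiniteDimensional ℂ E] (e : E →ₗ[ℂ] F) :
    ∃ C : ℝ, 0 < C ∧ ∀ x, ‖e x‖ ≤ C * ‖x‖ := by
  obtain ⟨C, hC, h⟩ := (LinearMap.toContinuousLinearMap e).bound
  exact ⟨C, hC, h⟩

theorem gram_aux_equiv {E : Type*} [inst : NormedAddCommGroup E] [hm : NormedSpace ℂ E]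
    [FiniteDimensional ℂ E] (N : E → ℝ)
    (hN_zero : ∀ A, N A = 0 ↔ A = 0)
    (hN_smul : ∀ (c : ℂ) (A), N (c • A) = ‖c‖ * N A)
    (hN_add : ∀ A B, N (A + B) ≤ N A + N B) :
    ∃ c C : ℝ, 0 < c ∧ 0 < C ∧ ∀ x, c * ‖x‖ ≤ N x ∧ N x ≤ C * ‖x‖ := by
  have hneg : ∀ A, N (-A) = N A := fun A => by simpa using hN_smul (-1) A
  have hnn : ∀ A, 0 ≤ N A := fun A => by
    have h := hN_add A (-A)
    rw [hneg, add_neg_cancel, (hN_zero 0).2 rfl] at h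
    linarith
  let iN : Norm E := ⟨N⟩
  have core : @NormedSpace.Core ℂ E _ _ _ iN :=
    @NormedSpace.Core.mk ℂ E _ _ _ iN
      (@SeminormedSpace.Core.mk ℂ E _ _ iN _ hnn hN_smul hN_add) (fun x => hN_zero x)
  let g2 : NormedAddCommGroup E := @NormedAddCommGroup.ofCore ℂ E _ _ _ iN core
  let s2 : @NormedSpace ℂ E _ g2.toSeminormedAddCommGroup :=
    @NormedSpace.ofCore ℂ E _ g2.toSeminormedAddCommGroup hm.toModule core
  obtain ⟨C, hC, h1⟩ := @gram_aux_bound E E inst _ g2 s2 _ (@LinearMap.id ℂ E _ _ hm.toModule)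
  obtain ⟨D, hD, h2⟩ := @gram_aux_bound E E g2 s2 inst _ ‹FiniteDimensional ℂ E› (@LinearMap.id ℂ E _ _ hm.toModule)
  refine ⟨D⁻¹, C, inv_pos.2 hD, hC, fun x => ⟨?_, h1 x⟩⟩
  rw [inv_mul_le_iff₀ hD]
  exact h2 x

open scoped Matrix.Norms.L2Operator in
theorem gram_aux_norm {p q : ℕ} (W : Matrix (Fin p) (Fin q) ℂ) (t : ℕ) :
    ‖(Wᴴ * W) ^ (2 ^ t)‖ = sigma1 W ^ (2 ^ (t + 1)) := by
  have h : IsSelfAdjoint (Wᴴ * W) := Matrix.isHermitian_conjTranspose_mul_self W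
  rw [h.norm_pow_two_pow, Matrix.l2_opNorm_conjTranspose_mul_self, ← pow_two, ← pow_mul,
    pow_succ' 2 t]
  rfl

/-- Gram iteration, convergence part: for any norm `N` on `q × q` complex matrices,
the sequence `t ↦ N((Wᴴ W)^(2^t)) ^ (2⁻¹^(t+1))` converges to the spectral norm of `W`. -/
theorem gram_iteration_tendsto_spectralNorm
    (p q : ℕ) (hp : 1 ≤ p) (hq : 1 ≤ q)
    (W : Matrix (Fin p) (Fin q) ℂ)
    (N : Matrix (Fin q) (Fin q) ℂ → ℝ)
    (hN_zero : ∀ A, N A = 0 ↔ A = 0)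
    (hN_smul : ∀ (c : ℂ) (A), N (c • A) = ‖c‖ * N A)
    (hN_add : ∀ A B, N (A + B) ≤ N A + N B) :
    Filter.Tendsto
      (fun t : ℕ => (N ((Wᴴ * W) ^ (2 ^ t))) ^ ((2:ℝ) ^ (-((t:ℝ) + 1))))
      Filter.atTop (nhds (sigma1 W)) := by
  obtain ⟨c, C, hc, hC, hN⟩ := @gram_aux_equiv (Matrix (Fin q) (Fin q) ℂ)
    Matrix.instL2OpNormedAddCommGroup Matrix.instL2OpNormedSpace inferInstance N
    hN_zero hN_smul hN_add
  have hs : 0 ≤ sigma1 W := norm_nonneg _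
  have he : Filter.Tendsto (fun t : ℕ => (2:ℝ) ^ (-((t:ℝ) + 1))) Filter.atTop (nhds 0) := by
    have h := (tendsto_pow_atTop_nhds_zero_of_lt_one (r := (1/2:ℝ)) (by norm_num)
      (by norm_num)).comp (Filter.tendsto_add_atTop_nat 1)
    refine h.congr fun t => ?_
    rw [Real.rpow_neg (by norm_num)]
    simp only [Function.comp, one_div, inv_pow]
    norm_cast
  have hroot : ∀ t : ℕ, (sigma1 W ^ (2 ^ (t + 1))) ^ ((2:ℝ) ^ (-((t:ℝ) + 1))) = sigma1 W := by
    intro t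
    rw [← Real.rpow_natCast, ← Real.rpow_mul hs, Real.rpow_neg (by norm_num)]
    have : (((2 ^ (t + 1) : ℕ)) : ℝ) = (2:ℝ) ^ ((t:ℝ) + 1) := by norm_cast
    rw [this, mul_inv_cancel₀ (by positivity), Real.rpow_one]
  have hlim : ∀ a : ℝ, 0 < a → Filter.Tendsto
      (fun t : ℕ => (a * sigma1 W ^ (2 ^ (t + 1))) ^ ((2:ℝ) ^ (-((t:ℝ) + 1))))
      Filter.atTop (nhds (sigma1 W)) := by
    intro a ha
    have h := ((Real.continuousAt_const_rpow ha.ne').tendsto.comp he).mul_const (sigma1 W)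
    rw [Real.rpow_zero, one_mul] at h
    refine h.congr fun t => ?_
    rw [Real.mul_rpow ha.le (by positivity), hroot]
    rfl
  refine tendsto_of_tendsto_of_tendsto_of_le_of_le (hlim c hc) (hlim C hC) ?_ ?_
  · intro t
    have h := (hN ((Wᴴ * W) ^ (2 ^ t))).1
    rw [gram_aux_norm] at h
    exact Real.rpow_le_rpow (by positivity) h (by positivity)
  · intro t
    have h1 := (hN ((Wᴴ * W) ^ (2 ^ t))).1
    have h := (hN ((Wᴴ * W) ^ (2 ^ t))).2
    rw [gram_aux_norm] at h h1
    exact Real.rpow_le_rpow (le_trans (by positivity) h1) h (by positivity)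
end

section
/- Let p, q ≥ 1, let W ∈ ℂ^{p×q}, and let N be a submultiplicative norm on the space of q×q complex matrices (N(AB) ≤ N(A)N(B) for all A, B). Then for every natural number t ≥ 0, σ₁(W) ≤ ( N( (Wᴴ W)^{2^t} ) )^{2^{-(t+1)}}. -/
open Matrix

open scoped Matrix.Norms.L2Operator in
theorem gram_aux (p q : ℕ) (hq : 1 ≤ q) (W : Matrix (Fin p) (Fin q) ℂ) :
    ∃ k ∈ spectrum ℂ (Wᴴ * W), ‖k‖ = sigma1 W ^ 2 := by
  haveI : Nonempty (Fin q) := ⟨⟨0, hq⟩⟩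
  haveI : CompleteSpace (Matrix (Fin q) (Fin q) ℂ) := FiniteDimensional.complete ℂ _
  letI : CStarAlgebra (Matrix (Fin q) (Fin q) ℂ) := {}
  obtain ⟨k, hk, hk2⟩ := spectrum.exists_nnnorm_eq_spectralRadius (Wᴴ * W)
  refine ⟨k, hk, ?_⟩
  have hsa : IsSelfAdjoint (Wᴴ * W) := Matrix.isHermitian_conjTranspose_mul_self W
  rw [hsa.spectralRadius_eq_nnnorm] at hk2
  have h3 : ‖k‖ = ‖Wᴴ * W‖ := by
    have := ENNReal.coe_injective hk2
    exact congrArg NNReal.toReal this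
  rw [h3, Matrix.l2_opNorm_conjTranspose_mul_self, sq]
  rfl

theorem gram_aux2 (q : ℕ)
    (N : Matrix (Fin q) (Fin q) ℂ → ℝ)
    (hN_zero : ∀ A, N A = 0 ↔ A = 0)
    (hN_smul : ∀ (c : ℂ) (A), N (c • A) = ‖c‖ * N A)
    (hN_add : ∀ A B, N (A + B) ≤ N A + N B)
    (hN_mul : ∀ A B, N (A * B) ≤ N A * N B)
    (A : Matrix (Fin q) (Fin q) ℂ) (k : ℂ) (hk : k ∈ spectrum ℂ A) : ‖k‖ ≤ N A := by
  rw [spectrum.mem_iff, Matrix.isUnit_iff_isUnit_det, isUnit_iff_ne_zero, not_not,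
    ← Matrix.exists_mulVec_eq_zero_iff] at hk
  obtain ⟨v, hv, hv2⟩ := hk
  have hAv : A *ᵥ v = k • v := by
    rw [Matrix.sub_mulVec, Algebra.algebraMap_eq_smul_one, Matrix.smul_mulVec,
      Matrix.one_mulVec, sub_eq_zero] at hv2
    exact hv2.symm
  set B : Matrix (Fin q) (Fin q) ℂ := Matrix.of fun i _ => v i with hB
  have hAB : A * B = k • B := by
    ext i j
    have := congrFun hAv i
    simpa [Matrix.mul_apply, Matrix.mulVec, dotProduct, hB] using this
  have hB0 : B ≠ 0 := by
    intro h
    apply hv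
    ext i
    exact congrFun (congrFun h i) i
  have hn : 0 ≤ N B := by
    have h1 := hN_add B ((-1 : ℂ) • B)
    rw [hN_smul] at h1
    have h2 : B + (-1 : ℂ) • B = 0 := by simp
    rw [h2, (hN_zero 0).2 rfl] at h1
    simp at h1
    linarith
  have hpos : 0 < N B := lt_of_le_of_ne hn (fun h => hB0 ((hN_zero B).1 h.symm))
  have := hN_mul A B
  rw [hAB, hN_smul] at this
  exact le_of_mul_le_mul_right this hpos

/-- Gram iteration, upper-bound part: for any submultiplicative (consistent) norm `N` on
`q × q` complex matrices, every iterate `N((Wᴴ W)^(2^t)) ^ (2⁻¹^(t+1))` upper bounds the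
spectral norm of `W`. -/
theorem gram_iteration_upper_bound
    (p q : ℕ) (hp : 1 ≤ p) (hq : 1 ≤ q)
    (W : Matrix (Fin p) (Fin q) ℂ)
    (N : Matrix (Fin q) (Fin q) ℂ → ℝ)
    (hN_zero : ∀ A, N A = 0 ↔ A = 0)
    (hN_smul : ∀ (c : ℂ) (A), N (c • A) = ‖c‖ * N A)
    (hN_add : ∀ A B, N (A + B) ≤ N A + N B)
    (hN_mul : ∀ A B, N (A * B) ≤ N A * N B) :
    ∀ t : ℕ, sigma1 W ≤ (N ((Wᴴ * W) ^ (2 ^ t))) ^ ((2:ℝ) ^ (-((t:ℝ) + 1))) := by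
  intro t
  obtain ⟨k, hk, hk2⟩ := gram_aux p q hq W
  have h := gram_aux2 q N hN_zero hN_smul hN_add hN_mul _ _ (spectrum.pow_mem_pow (Wᴴ * W) (2 ^ t) hk)
  rw [norm_pow, hk2, ← pow_mul] at h
  have hs : 0 ≤ sigma1 W := norm_nonneg _
  have he : (2:ℝ) ^ (-((t:ℝ) + 1)) = ((2 * 2 ^ t : ℕ) : ℝ)⁻¹ := by
    rw [Real.rpow_neg (by norm_num), Real.rpow_add (by norm_num), Real.rpow_natCast]
    push_cast
    rw [Real.rpow_one, mul_comm]
  rw [he]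
  calc sigma1 W = (sigma1 W ^ (2 * 2 ^ t)) ^ (((2 * 2 ^ t : ℕ) : ℝ)⁻¹) :=
        (Real.pow_rpow_inv_natCast hs (by positivity)).symm
    _ ≤ _ := Real.rpow_le_rpow (by positivity) h (by positivity)
end

section
/- Let p, q ≥ 1 and W ∈ ℂ^{p×q}. Then for every natural number t ≥ 0, σ₁(W) ≤ ( ‖ (Wᴴ W)^{2^t} ‖_F )^{2^{-(t+1)}} ≤ q^{2^{-(t+2)}} · σ₁(W), where ‖·‖_F is the Frobenius norm. In particular the Gram iteration bound with the Frobenius norm converges to σ₁(W) with error factor at most q^{2^{-(t+2)}}. -/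
open Matrix

/-- The Frobenius norm of a complex matrix. -/
noncomputable def frob {m n : Type*} [Fintype m] [Fintype n] (A : Matrix m n ℂ) : ℝ :=
  Real.sqrt (∑ i, ∑ j, ‖A i j‖ ^ 2)

lemma sigma1_le_frob' {m n : Type*} [Fintype m] [Fintype n] [DecidableEq n]
    (A : Matrix m n ℂ) : sigma1 A ≤ frob A := by
  unfold sigma1 frob
  refine ContinuousLinearMap.opNorm_le_bound _ (Real.sqrt_nonneg _) fun x => ?_
  rw [EuclideanSpace.norm_eq, EuclideanSpace.norm_eq, ← Real.sqrt_mul (by positivity)]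
  apply Real.sqrt_le_sqrt
  rw [Finset.sum_mul]
  refine Finset.sum_le_sum fun i _ => ?_
  have h1 : ‖(LinearMap.toContinuousLinearMap (Matrix.toEuclideanLin A) x) i‖
      ≤ ∑ j, ‖A i j‖ * ‖x j‖ := by
    have : (LinearMap.toContinuousLinearMap (Matrix.toEuclideanLin A) x) i
        = ∑ j, A i j * x j := rfl
    rw [this]
    refine (norm_sum_le _ _).trans_eq ?_
    simp
  calc _ ≤ (∑ j, ‖A i j‖ * ‖x j‖) ^ 2 := by gcongr
    _ ≤ _ := Finset.sum_mul_sq_le_sq_mul_sq _ _ _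

lemma frob_le_sigma1' {m n : Type*} [Fintype m] [Fintype n] [DecidableEq n]
    (A : Matrix m n ℂ) : frob A ≤ Real.sqrt (Fintype.card n) * sigma1 A := by
  have hs : 0 ≤ sigma1 A := norm_nonneg _
  unfold frob
  rw [Real.sqrt_le_left (by positivity), mul_pow, Real.sq_sqrt (by positivity), Finset.sum_comm]
  have h : ∀ j, ∑ i, ‖A i j‖ ^ 2 ≤ sigma1 A ^ 2 := by
    intro j
    have h1 := (LinearMap.toContinuousLinearMap (Matrix.toEuclideanLin A)).le_opNorm
      (EuclideanSpace.single j (1 : ℂ))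
    rw [EuclideanSpace.norm_single, norm_one, mul_one] at h1
    have h2 : ∑ i, ‖A i j‖ ^ 2 = ‖LinearMap.toContinuousLinearMap (Matrix.toEuclideanLin A)
      (EuclideanSpace.single j (1 : ℂ))‖ ^ 2 := by
      rw [EuclideanSpace.norm_sq_eq]
      simp
    rw [h2]
    exact pow_le_pow_left₀ (norm_nonneg _) h1 2
  refine (Finset.sum_le_sum fun j _ => h j).trans_eq ?_
  simp

open scoped Matrix.Norms.L2Operator in
lemma sigma1_gram {p q : ℕ} (W : Matrix (Fin p) (Fin q) ℂ) (t : ℕ) :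
    sigma1 ((Wᴴ * W) ^ (2 ^ t)) = sigma1 W ^ (2 ^ (t + 1)) := by
  have e : ∀ {m : ℕ} (A : Matrix (Fin m) (Fin q) ℂ), sigma1 A = ‖A‖ := fun A => rfl
  rw [e, e]
  have h : IsSelfAdjoint (Wᴴ * W) := Matrix.isHermitian_conjTranspose_mul_self W
  have := congrArg NNReal.toReal (h.nnnorm_pow_two_pow t)
  push_cast at this
  rw [this, l2_opNorm_conjTranspose_mul_self, ← pow_two, ← pow_mul, pow_succ, mul_comm]

/-- Gram iteration with the Frobenius norm: for every `t`,
`σ₁(W) ≤ ‖(Wᴴ W)^(2^t)‖_F ^ (2⁻¹^(t+1)) ≤ q ^ (2⁻¹^(t+2)) · σ₁(W)`. -/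
theorem gram_iteration_frobenius_rate
    (p q : ℕ) (hp : 1 ≤ p) (hq : 1 ≤ q)
    (W : Matrix (Fin p) (Fin q) ℂ) (t : ℕ) :
    sigma1 W ≤ (frob ((Wᴴ * W) ^ (2 ^ t))) ^ ((2:ℝ) ^ (-((t:ℝ) + 1))) ∧
      (frob ((Wᴴ * W) ^ (2 ^ t))) ^ ((2:ℝ) ^ (-((t:ℝ) + 1)))
        ≤ (q : ℝ) ^ ((2:ℝ) ^ (-((t:ℝ) + 2))) * sigma1 W := by
  have hs : 0 ≤ sigma1 W := norm_nonneg _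
  have hf : 0 ≤ frob ((Wᴴ * W) ^ (2 ^ t)) := Real.sqrt_nonneg _
  have h1 := sigma1_le_frob' ((Wᴴ * W) ^ (2 ^ t))
  have h2 := frob_le_sigma1' ((Wᴴ * W) ^ (2 ^ t))
  rw [sigma1_gram] at h1 h2
  rw [Fintype.card_fin] at h2
  have he : (2:ℝ) ^ (-((t:ℝ) + 1)) = (((2 ^ (t + 1) : ℕ)) : ℝ)⁻¹ := by
    rw [Real.rpow_neg (by norm_num)]
    push_cast
    rw [← Real.rpow_natCast]
    push_cast
    rfl
  have he2 : (2:ℝ) ^ (-((t:ℝ) + 2)) = (1 / 2) * (2:ℝ) ^ (-((t:ℝ) + 1)) := by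
    rw [show -((t:ℝ) + 2) = -1 + -((t:ℝ) + 1) by ring, Real.rpow_add (by norm_num),
      Real.rpow_neg_one]
    norm_num
  have hroot : (sigma1 W ^ (2 ^ (t + 1))) ^ ((2:ℝ) ^ (-((t:ℝ) + 1))) = sigma1 W := by
    rw [he]
    exact Real.pow_rpow_inv_natCast hs (by positivity)
  have hpos : 0 ≤ (2:ℝ) ^ (-((t:ℝ) + 1)) := by positivity
  constructor
  · have := Real.rpow_le_rpow (by positivity) h1 hpos
    rwa [hroot] at this
  · have := Real.rpow_le_rpow hf h2 hpos
    rwa [Real.mul_rpow (Real.sqrt_nonneg _) (by positivity), hroot, Real.sqrt_eq_rpow,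
      ← Real.rpow_mul (by positivity), ← he2] at this
end

section
/- Let K = (K_{j,i})_{j∈{1,…,c_out}, i∈{1,…,c_in}} be a multichannel convolution kernel, each K_{j,i}: ℤ² → ℝ finitely supported in {0,…,k−1}². Define the filter Gram iterates by K^{(1)} = K, K^{(2)}_{i₁,i₂} = Σ_{j=1}^{c_out} K_{j,i₁} ⋆ K_{j,i₂} for i₁,i₂ ∈ {1,…,c_in}, and K^{(t+1)}_{i₁,i₂} = Σ_{j=1}^{c_in} K^{(t)}_{j,i₁} ⋆ K^{(t)}_{j,i₂} for t ≥ 2, where ⋆ is the full cross-correlation. Let n ≥ 1, let c ∈ {0,…,k−1}², and let T ∈ ℝ^{c_out n² × c_in n²} be the zero-padded convolution matrix with entries T_{(j,u),(i,u′)} = K_{j,i}(u′ − u + c) for u, u′ ∈ {0,…,n−1}². Then for every t ≥ 1, σ₁(T) ≤ ( max_{i₂} Σ_{i₁} Σ_{s∈ℤ²} | K^{(t+1)}_{i₁,i₂}(s) | )^{2^{-t}}. -/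
open Matrix

/-- The spectral norm (largest singular value) of a real matrix, i.e. the operator norm
of the associated linear map between Euclidean spaces. -/
noncomputable def sigma1R {m n : Type*} [Fintype m] [Fintype n] [DecidableEq n]
    (A : Matrix m n ℝ) : ℝ :=
  ‖LinearMap.toContinuousLinearMap (Matrix.toEuclideanLin A)‖

/-- Full cross-correlation of two finitely supported functions on `ℤ²`:
`(A ⋆ B)(s) = ∑_{a ∈ ℤ²} A(a+s)·B(a)`. -/
noncomputable def crossCorr (A B : ℤ × ℤ → ℝ) : ℤ × ℤ → ℝ :=
  fun s => ∑ᶠ a : ℤ × ℤ, A (a + s) * B a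

/-- Gram iterates of a multichannel filter: `filterGramIter K 0 = K⁽²⁾` with
`K⁽²⁾_{i₁,i₂} = ∑_j K_{j,i₁} ⋆ K_{j,i₂}`, and `filterGramIter K (t-1) = K⁽ᵗ⁺¹⁾` in general,
via `K⁽ᵗ⁺¹⁾_{i₁,i₂} = ∑_j K⁽ᵗ⁾_{j,i₁} ⋆ K⁽ᵗ⁾_{j,i₂}` for `t ≥ 2`. -/
noncomputable def filterGramIter {cout cin : ℕ} (K : Fin cout → Fin cin → ℤ × ℤ → ℝ) :
    ℕ → Fin cin → Fin cin → ℤ × ℤ → ℝ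
  | 0 => fun i1 i2 => ∑ j : Fin cout, crossCorr (K j i1) (K j i2)
  | t + 1 => fun i1 i2 =>
      ∑ j : Fin cin, crossCorr (filterGramIter K t j i1) (filterGramIter K t j i2)

open Classical in
/-- Push-forward of a finitely supported function along `φ`. -/
noncomputable def perz {G : Type*} [AddCommGroup G] (φ : ℤ × ℤ →+ G) (f : ℤ × ℤ → ℝ) (v : G) : ℝ :=
  ∑ᶠ s : ℤ × ℤ, if φ s = v then f s else 0

lemma fin_exists {f : ℤ × ℤ → ℝ} (hf : f.HasFiniteSupport) :
    ∃ S : Finset (ℤ × ℤ), f.support ⊆ S := by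
  have h : f.support.Finite := hf
  exact ⟨h.toFinset, by rw [Set.Finite.coe_toFinset]⟩

lemma fin_ite {f : ℤ × ℤ → ℝ} (hf : f.HasFiniteSupport) (p : ℤ × ℤ → Prop) [DecidablePred p] :
    (fun s => if p s then f s else 0).HasFiniteSupport := by
  refine Set.Finite.subset hf ?_
  intro s hs
  simp only [Function.mem_support] at hs ⊢
  intro h
  simp [h] at hs

lemma fin_shift {f : ℤ × ℤ → ℝ} (hf : f.HasFiniteSupport) (a : ℤ × ℤ) :
    (fun s => f (a + s)).HasFiniteSupport := by
  have := Set.Finite.preimage (f := fun s => a + s) (add_right_injective a).injOn hf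
  exact this

lemma crossCorr_eq (f g : ℤ × ℤ → ℝ) (S : Finset (ℤ × ℤ)) (hS : g.support ⊆ S) (s : ℤ × ℤ) :
    crossCorr f g s = ∑ a ∈ S, f (a + s) * g a := by
  unfold crossCorr
  apply finsum_eq_sum_of_support_subset
  intro a ha
  apply hS
  simp only [Function.mem_support] at ha ⊢
  exact right_ne_zero_of_mul ha

lemma fin_sum {ι : Type*} (S : Finset ι) (F : ι → ℤ × ℤ → ℝ)
    (h : ∀ a ∈ S, (F a).HasFiniteSupport) : (fun s => ∑ a ∈ S, F a s).HasFiniteSupport := by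
  have : (⋃ a ∈ S, (F a).support).Finite := Set.Finite.biUnion S.finite_toSet h
  refine Set.Finite.subset this ?_
  intro s hs
  simp only [Function.mem_support] at hs
  obtain ⟨a, ha, h'⟩ := Finset.exists_ne_zero_of_sum_ne_zero hs
  simp only [Set.mem_iUnion]
  exact ⟨a, ha, h'⟩

lemma fin_crossCorr {f g : ℤ × ℤ → ℝ} (hf : f.HasFiniteSupport) (hg : g.HasFiniteSupport) :
    (crossCorr f g).HasFiniteSupport := by
  obtain ⟨S, hS⟩ : ∃ S : Finset (ℤ × ℤ), g.support ⊆ S := fin_exists hg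
  have : crossCorr f g = fun s => ∑ a ∈ S, f (a + s) * g a := by
    funext s
    exact crossCorr_eq f g _ hS s
  rw [this]
  apply fin_sum
  intro a _
  refine Set.Finite.subset (fin_shift hf a) ?_
  intro s hs
  exact left_ne_zero_of_mul hs

lemma fin_crossSum {m l : ℕ} (K : Fin m → Fin l → ℤ × ℤ → ℝ) (hK : ∀ j i, (K j i).HasFiniteSupport)
    (i1 i2 : Fin l) : (∑ j, crossCorr (K j i1) (K j i2)).HasFiniteSupport := by
  have := fin_sum Finset.univ (fun j => crossCorr (K j i1) (K j i2))
    (fun j _ => fin_crossCorr (hK j i1) (hK j i2))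
  convert this using 1
  funext s
  simp

lemma perz_sum {G : Type*} [AddCommGroup G] (φ : ℤ × ℤ →+ G) {ι : Type*} (S : Finset ι)
    (F : ι → ℤ × ℤ → ℝ) (h : ∀ a ∈ S, (F a).HasFiniteSupport) (v : G) :
    perz φ (fun s => ∑ a ∈ S, F a s) v = ∑ a ∈ S, perz φ (F a) v := by
  classical
  unfold perz
  rw [← finsum_sum_comm]
  · refine finsum_congr fun s => ?_
    split_ifs <;> simp
  · intro b hb
    exact fin_ite (h b hb) _

lemma perz_crossCorr {G : Type*} [AddCommGroup G] [Fintype G] (φ : ℤ × ℤ →+ G)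
    {f g : ℤ × ℤ → ℝ} (hf : f.HasFiniteSupport) (hg : g.HasFiniteSupport) (v1 v2 : G) :
    ∑ u, perz φ f (v1 - u) * perz φ g (v2 - u) = perz φ (crossCorr f g) (v1 - v2) := by
  classical
  obtain ⟨S, hS⟩ : ∃ S : Finset (ℤ × ℤ), g.support ⊆ S := fin_exists hg
  have e1 : crossCorr f g = fun s => ∑ a ∈ S, f (a + s) * g a := by
    funext s
    exact crossCorr_eq f g _ hS s
  have e2 : ∀ v, perz φ g v = ∑ a ∈ S, if φ a = v then g a else 0 := by
    intro v
    apply finsum_eq_sum_of_support_subset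
    intro a ha
    apply hS
    simp only [Function.mem_support] at ha ⊢
    intro h
    simp [h] at ha
  have e3 : ∀ a v, perz φ (fun s => f (a + s) * g a) v = perz φ f (v + φ a) * g a := by
    intro a v
    unfold perz
    rw [finsum_mul, ← finsum_comp_equiv (Equiv.addLeft a) (f := fun s => (if φ s = v + φ a then f s else 0) * g a)]
    · refine finsum_congr fun s => ?_
      have : φ (a + s) = v + φ a ↔ φ s = v := by
        rw [map_add, add_comm]
        exact add_left_inj _
      simp only [Equiv.coe_addLeft, this]
      split_ifs <;> simp
  rw [e1, perz_sum]
  · simp only [e2, e3, Finset.mul_sum]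
    rw [Finset.sum_comm]
    refine Finset.sum_congr rfl fun a _ => ?_
    rw [Finset.sum_eq_single (v2 - φ a)]
    · simp only [sub_sub_cancel, if_true]
      congr 2
      abel
    · intro u _ hu
      rw [if_neg, mul_zero]
      intro h
      apply hu
      rw [h]; abel
    · simp
  · intro a _
    refine Set.Finite.subset (fin_shift hf a) ?_
    intro s hs
    exact left_ne_zero_of_mul hs

lemma perz_abs {G : Type*} [AddCommGroup G] [Fintype G] (φ : ℤ × ℤ →+ G)
    {f : ℤ × ℤ → ℝ} (hf : f.HasFiniteSupport) :
    ∑ u, |perz φ f u| ≤ ∑ᶠ s, |f s| := by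
  classical
  obtain ⟨S, hS⟩ : ∃ S : Finset (ℤ × ℤ), f.support ⊆ S := fin_exists hf
  have e2 : ∀ v, perz φ f v = ∑ a ∈ S, if φ a = v then f a else 0 := by
    intro v
    apply finsum_eq_sum_of_support_subset
    intro a ha
    apply hS
    simp only [Function.mem_support] at ha ⊢
    intro h
    simp [h] at ha
  have e3 : ∑ᶠ s, |f s| = ∑ a ∈ S, |f a| := by
    apply finsum_eq_sum_of_support_subset
    intro a ha
    apply hS
    simpa using ha
  rw [e3]
  calc ∑ u, |perz φ f u| ≤ ∑ u, ∑ a ∈ S, if φ a = u then |f a| else 0 := by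
        refine Finset.sum_le_sum fun u _ => ?_
        rw [e2]
        refine (Finset.abs_sum_le_sum_abs _ _).trans (le_of_eq ?_)
        refine Finset.sum_congr rfl fun a _ => ?_
        split_ifs <;> simp
    _ = ∑ a ∈ S, |f a| := by
        rw [Finset.sum_comm]
        simp

/-- circulant matrix of a kernel -/
noncomputable def circM {G : Type*} [AddCommGroup G] (φ : ℤ × ℤ →+ G) {m l : ℕ}
    (K : Fin m → Fin l → ℤ × ℤ → ℝ) : Matrix (Fin m × G) (Fin l × G) ℝ :=
  fun p q => perz φ (K p.1 q.1) (q.2 - p.2)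

/-- the flipped circulant matrix of a kernel -/
noncomputable def circD {G : Type*} [AddCommGroup G] (φ : ℤ × ℤ →+ G) {m l : ℕ}
    (K : Fin m → Fin l → ℤ × ℤ → ℝ) : Matrix (Fin m × G) (Fin l × G) ℝ :=
  fun p q => perz φ (K p.1 q.1) (p.2 - q.2)

lemma circ_gram {G : Type*} [AddCommGroup G] [Fintype G] (φ : ℤ × ℤ →+ G) {m l : ℕ}
    (K : Fin m → Fin l → ℤ × ℤ → ℝ) (hK : ∀ j i, (K j i).HasFiniteSupport) :
    (circM φ K)ᴴ * circM φ K =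
      circD φ (fun i1 i2 => ∑ j, crossCorr (K j i1) (K j i2)) := by
  ext ⟨i1, v1⟩ ⟨i2, v2⟩
  simp only [Matrix.mul_apply, Matrix.conjTranspose_apply, circM, circD, star_trivial,
    Fintype.sum_prod_type]
  have : (∑ j, crossCorr (K j i1) (K j i2)) = fun s => ∑ j, crossCorr (K j i1) (K j i2) s := by
    funext s; simp
  rw [this, perz_sum]
  · exact Finset.sum_congr rfl fun j _ => perz_crossCorr φ (hK _ _) (hK _ _) _ _
  · exact fun j _ => fin_crossCorr (hK _ _) (hK _ _)

lemma sigma1R_nonneg {m n : Type*} [Fintype m] [Fintype n] [DecidableEq n]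
    (A : Matrix m n ℝ) : 0 ≤ sigma1R A := norm_nonneg _

lemma sigma1R_gram {m n : Type*} [Fintype m] [Fintype n] [DecidableEq n]
    (A : Matrix m n ℝ) : sigma1R (Aᴴ * A) = sigma1R A ^ 2 := by
  rw [sq]
  exact Matrix.l2_opNorm_conjTranspose_mul_self A

lemma sigma1R_le {m n : Type*} [Fintype m] [Fintype n] [DecidableEq n]
    (A : Matrix m n ℝ) (M : ℝ) (hM : 0 ≤ M)
    (h : ∀ x : n → ℝ, ∑ i, (A *ᵥ x) i ^ 2 ≤ M ^ 2 * ∑ j, x j ^ 2) : sigma1R A ≤ M := by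
  unfold sigma1R
  refine ContinuousLinearMap.opNorm_le_bound _ hM fun x => ?_
  refine le_of_sq_le_sq ?_ (by positivity)
  rw [mul_pow, EuclideanSpace.real_norm_sq_eq, EuclideanSpace.real_norm_sq_eq]
  exact h x

lemma le_sigma1R {m n : Type*} [Fintype m] [Fintype n] [DecidableEq n]
    (A : Matrix m n ℝ) (x : n → ℝ) :
    ∑ i, (A *ᵥ x) i ^ 2 ≤ sigma1R A ^ 2 * ∑ j, x j ^ 2 := by
  have h := ContinuousLinearMap.le_opNorm
    (LinearMap.toContinuousLinearMap (Matrix.toEuclideanLin A)) (WithLp.toLp 2 x)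
  have h2 := pow_le_pow_left₀ (norm_nonneg _) h 2
  rw [mul_pow, EuclideanSpace.real_norm_sq_eq, EuclideanSpace.real_norm_sq_eq] at h2
  exact h2

lemma sigma1R_submatrix {m n m' n' : Type*} [Fintype m] [Fintype n] [DecidableEq n]
    [Fintype m'] [Fintype n'] [DecidableEq n'] (A : Matrix m n ℝ) (f : m' → m) (g : n' → n)
    (hf : f.Injective) (hg : g.Injective) : sigma1R (A.submatrix f g) ≤ sigma1R A := by
  classical
  refine sigma1R_le _ _ (sigma1R_nonneg _) fun x => ?_
  set y : n → ℝ := Function.extend g x 0 with hy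
  have hyg : ∀ j, y (g j) = x j := fun j => hg.extend_apply _ _ _
  have hy0 : ∀ j, j ∉ Set.range g → y j = 0 := fun j hj => by
    rw [hy, Function.extend_apply' _ _ _ (by simpa using hj)]; rfl
  have hs : ∑ j, y j ^ 2 = ∑ j, x j ^ 2 := by
    rw [← Fintype.sum_of_injective g hg (fun j => x j ^ 2) (fun j => y j ^ 2)]
    · intro j hj; simp [hy0 j hj]
    · intro j; simp [hyg]
  have hm : ∀ i, (A.submatrix f g *ᵥ x) i = (A *ᵥ y) (f i) := by
    intro i
    simp only [Matrix.mulVec, dotProduct, Matrix.submatrix_apply]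
    apply Fintype.sum_of_injective g hg
    · intro j hj; simp [hy0 j hj]
    · intro j; simp [hyg]
  rw [← hs]
  refine le_trans ?_ (le_sigma1R A y)
  simp only [hm]
  rw [← Finset.sum_image (f := fun i => (A *ᵥ y) i ^ 2) (g := f) (s := Finset.univ) hf.injOn]
  exact Finset.sum_le_univ_sum_of_nonneg fun i => sq_nonneg _

lemma sigma1R_schur {n : Type*} [Fintype n] [DecidableEq n] (A : Matrix n n ℝ)
    (hA : ∀ i j, A i j = A j i) (M : ℝ) (hM : 0 ≤ M) (h : ∀ j, ∑ i, |A i j| ≤ M) :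
    sigma1R A ≤ M := by
  refine sigma1R_le _ _ hM fun x => ?_
  calc ∑ i, (A *ᵥ x) i ^ 2 ≤ ∑ i, M * ∑ j, |A i j| * x j ^ 2 := by
        refine Finset.sum_le_sum fun i _ => ?_
        have h1 : (A *ᵥ x) i ^ 2 ≤ (∑ j, |A i j|) * ∑ j, |A i j| * x j ^ 2 := by
          simp only [Matrix.mulVec, dotProduct]
          refine Finset.sum_sq_le_sum_mul_sum_of_sq_le_mul _ (fun _ _ => abs_nonneg _)
            (fun _ _ => by positivity) fun j _ => ?_
          rw [mul_pow, ← sq_abs (A i j)]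
          exact le_of_eq (by ring)
        refine h1.trans (mul_le_mul_of_nonneg_right ?_
          (Finset.sum_nonneg fun _ _ => by positivity))
        refine le_trans (le_of_eq ?_) (h i)
        exact Finset.sum_congr rfl fun j _ => by rw [hA]
    _ = M * ∑ j, (∑ i, |A i j|) * x j ^ 2 := by
        rw [← Finset.mul_sum, Finset.sum_comm]
        simp only [Finset.sum_mul]
    _ ≤ M * ∑ j, M * x j ^ 2 := by
        gcongr with j _
        exact h j
    _ = M ^ 2 * ∑ j, x j ^ 2 := by
        rw [← Finset.mul_sum]; ring

lemma circD_le {G : Type*} [AddCommGroup G] [Fintype G] [DecidableEq G] (φ : ℤ × ℤ →+ G) {m l : ℕ}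
    (K : Fin m → Fin l → ℤ × ℤ → ℝ) : sigma1R (circD φ K) ≤ sigma1R (circM φ K) := by
  have : circD φ K = (circM φ K).submatrix (Prod.map id Neg.neg) (Prod.map id Neg.neg) := by
    ext ⟨i, u⟩ ⟨j, v⟩
    simp only [circD, circM, Matrix.submatrix_apply, Prod.map, id]
    congr 1
    abel
  rw [this]
  exact sigma1R_submatrix _ _ _ (Function.injective_id.prodMap neg_injective)
    (Function.injective_id.prodMap neg_injective)

lemma fin_iter {cout cin : ℕ} (K : Fin cout → Fin cin → ℤ × ℤ → ℝ)
    (hK : ∀ j i, (K j i).HasFiniteSupport) (t : ℕ) :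
    ∀ i1 i2, (filterGramIter K t i1 i2).HasFiniteSupport := by
  induction t with
  | zero => exact fun i1 i2 => fin_crossSum K hK i1 i2
  | succ t ih => exact fun i1 i2 => fin_crossSum _ ih i1 i2

lemma circ_iter {G : Type*} [AddCommGroup G] [Fintype G] [DecidableEq G] (φ : ℤ × ℤ →+ G)
    {cout cin : ℕ} (K : Fin cout → Fin cin → ℤ × ℤ → ℝ)
    (hK : ∀ j i, (K j i).HasFiniteSupport) (t : ℕ) :
    sigma1R (circM φ K) ^ (2 ^ (t + 1)) ≤ sigma1R (circD φ (filterGramIter K t)) := by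
  induction t with
  | zero =>
    have h := sigma1R_gram (circM φ K)
    rw [circ_gram φ K hK] at h
    rw [zero_add, pow_one]
    exact h.ge
  | succ t ih =>
    have h := sigma1R_gram (circM φ (filterGramIter K t))
    rw [circ_gram φ _ (fin_iter K hK t)] at h
    change sigma1R (circD φ (filterGramIter K (t + 1))) = _ at h
    rw [h, pow_succ, pow_mul]
    exact pow_le_pow_left₀ (pow_nonneg (sigma1R_nonneg _) _) (ih.trans (circD_le _ _)) 2

lemma circD_symm {G : Type*} [AddCommGroup G] [Fintype G] (φ : ℤ × ℤ →+ G)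
    {cout cin : ℕ} (K : Fin cout → Fin cin → ℤ × ℤ → ℝ)
    (hK : ∀ j i, (K j i).HasFiniteSupport) (t : ℕ) (p q) :
    circD φ (filterGramIter K t) p q = circD φ (filterGramIter K t) q p := by
  have key : ∀ {m l : ℕ} (K : Fin m → Fin l → ℤ × ℤ → ℝ) (_ : ∀ j i, (K j i).HasFiniteSupport) p q,
      circD φ (fun i1 i2 => ∑ j, crossCorr (K j i1) (K j i2)) p q =
      circD φ (fun i1 i2 => ∑ j, crossCorr (K j i1) (K j i2)) q p := by
    intro m l K hK p q
    rw [← circ_gram φ K hK]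
    simp only [Matrix.mul_apply, Matrix.conjTranspose_apply, star_trivial]
    exact Finset.sum_congr rfl fun _ _ => mul_comm _ _
  cases t with
  | zero => exact key K hK p q
  | succ t => exact key _ (fin_iter K hK t) p q

lemma circD_bound {G : Type*} [AddCommGroup G] [Fintype G] [DecidableEq G] (φ : ℤ × ℤ →+ G)
    {cout cin : ℕ} (K : Fin cout → Fin cin → ℤ × ℤ → ℝ)
    (hK : ∀ j i, (K j i).HasFiniteSupport) (t : ℕ) :
    sigma1R (circD φ (filterGramIter K t)) ≤
      ⨆ i2 : Fin cin, ∑ i1 : Fin cin, ∑ᶠ s : ℤ × ℤ, |filterGramIter K t i1 i2 s| := by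
  refine sigma1R_schur _ (circD_symm φ K hK t) _ ?_ ?_
  · exact Real.iSup_nonneg fun i => Finset.sum_nonneg fun j _ => finsum_nonneg fun s => abs_nonneg _
  · rintro ⟨i2, v2⟩
    refine le_trans ?_ (le_ciSup (Set.finite_range _).bddAbove i2)
    simp only [circD, Fintype.sum_prod_type]
    refine Finset.sum_le_sum fun i1 _ => ?_
    refine le_trans (le_of_eq ?_) (perz_abs φ (fin_iter K hK t i1 i2))
    exact Fintype.sum_equiv (Equiv.subRight v2) _ _ fun u => rfl

/-- Gram-iteration bound (∞-norm version) on the spectral norm of a zero-padded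
convolution matrix `T`, in terms of the filter Gram iterates `K⁽ᵗ⁺¹⁾`. -/
theorem spectral_norm_zero_padded_conv_le_filter_gram_bound
    (cout cin k n : ℕ) (hcout : 1 ≤ cout) (hcin : 1 ≤ cin) (hn : 1 ≤ n)
    (K : Fin cout → Fin cin → ℤ × ℤ → ℝ)
    (hK : ∀ j i s, K j i s ≠ 0 → 0 ≤ s.1 ∧ s.1 < (k:ℤ) ∧ 0 ≤ s.2 ∧ s.2 < (k:ℤ))
    (c : ℤ × ℤ) (hc : 0 ≤ c.1 ∧ c.1 < (k:ℤ) ∧ 0 ≤ c.2 ∧ c.2 < (k:ℤ))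
    (T : Matrix (Fin cout × Fin n × Fin n) (Fin cin × Fin n × Fin n) ℝ)
    (hT : ∀ (j : Fin cout) (i : Fin cin) (u u' : Fin n × Fin n),
      T (j, u) (i, u') =
        K j i (((u'.1 : ℤ) - (u.1 : ℤ) + c.1, (u'.2 : ℤ) - (u.2 : ℤ) + c.2))) :
    ∀ t : ℕ, 1 ≤ t →
      sigma1R T ≤
        (⨆ i2 : Fin cin, ∑ i1 : Fin cin, ∑ᶠ s : ℤ × ℤ, |filterGramIter K (t - 1) i1 i2 s|)
          ^ ((2:ℝ) ^ (-(t:ℝ))) := by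
  intro t ht
  obtain ⟨t, rfl⟩ : ∃ r, t = r + 1 := ⟨t - 1, by omega⟩
  rw [Nat.add_sub_cancel]
  have hfin : ∀ j i, (K j i).HasFiniteSupport := by
    intro j i
    refine Set.Finite.subset (Set.finite_Icc ((0 : ℤ), (0 : ℤ)) ((k : ℤ), (k : ℤ))) ?_
    intro s hs
    have := hK j i s hs
    simp only [Set.mem_Icc, Prod.le_def]
    omega
  set N : ℕ := n + k with hN
  haveI : NeZero N := ⟨by omega⟩
  let φ : ℤ × ℤ →+ ZMod N × ZMod N :=
    (Int.castAddHom (ZMod N)).prodMap (Int.castAddHom (ZMod N))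
  have hφ : ∀ s s', φ s = φ s' → (N : ℤ) ∣ s.1 - s'.1 ∧ (N : ℤ) ∣ s.2 - s'.2 := by
    intro s s' h
    have h1 := congrArg Prod.fst h
    have h2 := congrArg Prod.snd h
    simp only [φ, AddMonoidHom.prodMap, AddMonoidHom.prod_apply, AddMonoidHom.comp_apply,
      AddMonoidHom.coe_fst, AddMonoidHom.coe_snd, Int.coe_castAddHom] at h1 h2
    rw [ZMod.intCast_eq_intCast_iff_dvd_sub] at h1 h2
    exact ⟨(dvd_sub_comm).1 h1, (dvd_sub_comm).1 h2⟩
  have hsmall : ∀ z : ℤ, (N : ℤ) ∣ z → |z| < N → z = 0 := fun z h1 h2 =>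
    Int.eq_zero_of_abs_lt_dvd h1 h2
  let ι : Fin n × Fin n → ℤ × ℤ := fun u => ((u.1 : ℤ), (u.2 : ℤ))
  have hι : ∀ u u', φ (ι u) = φ (ι u') → u = u' := by
    intro u u' h
    obtain ⟨h1, h2⟩ := hφ _ _ h
    have a1 := hsmall _ h1 (by rw [abs_lt]; simp only [ι]; omega)
    have a2 := hsmall _ h2 (by rw [abs_lt]; simp only [ι]; omega)
    simp only [ι] at a1 a2
    ext <;> omega
  have hsub : T = (circM φ K).submatrix (fun p => (p.1, φ (ι p.2) - φ c))
      (fun p => (p.1, φ (ι p.2))) := by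
    classical
    ext ⟨j, u⟩ ⟨i, u'⟩
    rw [hT]
    simp only [Matrix.submatrix_apply, circM, perz]
    have e : φ (ι u') - (φ (ι u) - φ c) = φ (ι u' - ι u + c) := by
      simp only [map_add, map_sub]; abel
    rw [e, finsum_eq_single _ (ι u' - ι u + c)]
    · simp only [if_true]; rfl
    · intro s hs
      split_ifs with h
      · by_contra h0
        apply hs
        have hb := hK j i s h0
        obtain ⟨h1, h2⟩ := hφ _ _ h
        simp only [ι, Prod.fst_add, Prod.snd_add, Prod.fst_sub, Prod.snd_sub] at h1 h2
        have a1 := hsmall _ h1 (by rw [abs_lt]; omega)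
        have a2 := hsmall _ h2 (by rw [abs_lt]; omega)
        ext
        · simp only [ι, Prod.fst_add, Prod.fst_sub]; omega
        · simp only [ι, Prod.snd_add, Prod.snd_sub]; omega
      · rfl
  have hle : sigma1R T ≤ sigma1R (circM φ K) := by
    rw [hsub]
    apply sigma1R_submatrix
    · rintro ⟨j, u⟩ ⟨j', u'⟩ h
      simp only [Prod.mk.injEq, sub_left_inj] at h
      rw [h.1, hι _ _ h.2]
    · rintro ⟨j, u⟩ ⟨j', u'⟩ h
      rw [Prod.mk.injEq] at h
      exact Prod.ext h.1 (hι _ _ h.2)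
  have hpow := (pow_le_pow_left₀ (sigma1R_nonneg T) hle (2 ^ (t + 1))).trans
    ((circ_iter φ K hfin t).trans (circD_bound φ K hfin t))
  have hr := Real.rpow_le_rpow (pow_nonneg (sigma1R_nonneg T) _) hpow
    (z := (2:ℝ) ^ (-((t + 1 : ℕ):ℝ))) (by positivity)
  refine le_trans (le_of_eq ?_) hr
  rw [Real.rpow_neg (by norm_num), Real.rpow_natCast]
  have := Real.pow_rpow_inv_natCast (sigma1R_nonneg T) (n := 2 ^ (t + 1)) (by positivity)
  rw [Nat.cast_pow, Nat.cast_ofNat] at this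
  exact this.symm
end

section
/- Let K = (K_{j,i})_{j∈{1,…,c_out}, i∈{1,…,c_in}} be a multichannel convolution kernel, each K_{j,i}: ℤ² → ℝ finitely supported in {0,…,k−1}², and let n ≥ 1. Let T_f ∈ ℝ^{c_out(n+k−1)² × c_in n²} be the maximal-padding convolution matrix with entries (T_f)_{(j,w),(i,u′)} = K_{j,i}(u′ − w + (k−1,k−1)) for w ∈ {0,…,n+k−2}² and u′ ∈ {0,…,n−1}². Then for all i₁, i₂ ∈ {1,…,c_in} and u₁, u₂ ∈ {0,…,n−1}², (T_fᵀ T_f)_{(i₁,u₁),(i₂,u₂)} = Σ_{j=1}^{c_out} ( K_{j,i₂} ⋆ K_{j,i₁} )(u₂ − u₁), where ⋆ is the full cross-correlation. -/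
open Matrix

/-- The first Gram iterate `T_fᵀ T_f` of the maximal-padding convolution matrix `T_f` is the
multi-level Toeplitz matrix whose entries are the channel-summed cross-correlations of the
filters. -/
theorem gram_of_maximal_padding_conv_eq_crossCorr
    (cout cin k n : ℕ) (hcout : 1 ≤ cout) (hcin : 1 ≤ cin) (hk : 1 ≤ k) (hn : 1 ≤ n)
    (K : Fin cout → Fin cin → ℤ × ℤ → ℝ)
    (hK : ∀ j i s, K j i s ≠ 0 → 0 ≤ s.1 ∧ s.1 < (k:ℤ) ∧ 0 ≤ s.2 ∧ s.2 < (k:ℤ))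
    (Tf : Matrix (Fin cout × Fin (n + k - 1) × Fin (n + k - 1)) (Fin cin × Fin n × Fin n) ℝ)
    (hTf : ∀ (j : Fin cout) (i : Fin cin) (w : Fin (n + k - 1) × Fin (n + k - 1))
        (u' : Fin n × Fin n),
      Tf (j, w) (i, u') =
        K j i (((u'.1 : ℤ) - (w.1 : ℤ) + ((k:ℤ) - 1), (u'.2 : ℤ) - (w.2 : ℤ) + ((k:ℤ) - 1)))) :
    ∀ (i1 i2 : Fin cin) (u1 u2 : Fin n × Fin n),
      (Tfᵀ * Tf) (i1, u1) (i2, u2) =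
        ∑ j : Fin cout,
          crossCorr (K j i2) (K j i1) (((u2.1 : ℤ) - (u1.1 : ℤ), (u2.2 : ℤ) - (u1.2 : ℤ))) := by
  intro i1 i2 u1 u2
  rw [Matrix.mul_apply, Fintype.sum_prod_type]
  refine Finset.sum_congr rfl fun j _ => ?_
  simp only [Matrix.transpose_apply, hTf, crossCorr]
  let f : Fin (n + k - 1) × Fin (n + k - 1) → ℤ × ℤ := fun w =>
    ((u1.1 : ℤ) - (w.1 : ℤ) + ((k:ℤ) - 1), (u1.2 : ℤ) - (w.2 : ℤ) + ((k:ℤ) - 1))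
  have hf : Function.Injective f := by
    rintro ⟨a, b⟩ ⟨c, d⟩ h
    simp only [f, Prod.mk.injEq] at h
    ext <;> simp only <;> omega
  rw [finsum_eq_sum_of_support_subset (s := Finset.univ.image f), Finset.sum_image hf.injOn]
  · refine Finset.sum_congr rfl fun w _ => ?_
    rw [mul_comm]
    congr 2
    ext <;> simp only [f, Prod.fst_add, Prod.snd_add] <;> ring
  · rintro ⟨x, y⟩ h
    have h1 := hK j i1 (x, y) (right_ne_zero_of_mul h)
    simp only at h1
    have l1 := u1.1.isLt
    have l2 := u1.2.isLt
    simp only [Finset.coe_image, Finset.coe_univ, Set.image_univ, Set.mem_range]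
    refine ⟨(⟨((u1.1 : ℤ) + ((k:ℤ) - 1) - x).toNat, by omega⟩,
      ⟨((u1.2 : ℤ) + ((k:ℤ) - 1) - y).toNat, by omega⟩), ?_⟩
    simp only [f, Prod.mk.injEq]
    constructor <;> omega
end

section
/- Let K = (K_{j,i})_{j∈{1,…,c_out}, i∈{1,…,c_in}} be a multichannel convolution kernel, each K_{j,i}: ℤ² → ℝ finitely supported in {0,…,k−1}², let n ≥ 1 and c ∈ {0,…,k−1}². Let T ∈ ℝ^{c_out n² × c_in n²} be the zero-padded convolution matrix with entries T_{(j,u),(i,u′)} = K_{j,i}(u′ − u + c) for u, u′ ∈ {0,…,n−1}², and let T_f ∈ ℝ^{c_out(n+k−1)² × c_in n²} be the maximal-padding convolution matrix with entries (T_f)_{(j,w),(i,u′)} = K_{j,i}(u′ − w + (k−1,k−1)) for w ∈ {0,…,n+k−2}². Then σ₁(T) ≤ σ₁(T_f). -/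
open Matrix

theorem sigma1R_le_of_rows {m m' n : Type*} [Fintype m] [Fintype m'] [Fintype n] [DecidableEq n]
    (A : Matrix m n ℝ) (B : Matrix m' n ℝ) (e : m → m') (he : Function.Injective e)
    (h : ∀ i j, A i j = B (e i) j) : sigma1R A ≤ sigma1R B := by
  classical
  unfold sigma1R
  refine ContinuousLinearMap.opNorm_le_bound _ (norm_nonneg _) fun x => ?_
  refine le_trans ?_ (ContinuousLinearMap.le_opNorm _ x)
  rw [EuclideanSpace.norm_eq, EuclideanSpace.norm_eq]
  apply Real.sqrt_le_sqrt
  have hx : ∀ i, (LinearMap.toContinuousLinearMap (Matrix.toEuclideanLin A) x) i =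
      (LinearMap.toContinuousLinearMap (Matrix.toEuclideanLin B) x) (e i) := by
    intro i
    simp [Matrix.toLpLin_apply, Matrix.mulVec, dotProduct, h]
  simp only [hx]
  rw [← Finset.sum_image (s := Finset.univ) (g := e)
    (f := fun w => ‖(LinearMap.toContinuousLinearMap (Matrix.toEuclideanLin B) x) w‖ ^ 2)
    (fun a _ b _ hab => he hab)]
  exact Finset.sum_le_sum_of_subset_of_nonneg (Finset.subset_univ _) (fun _ _ _ => sq_nonneg _)

/-- The spectral norm of a same-size zero-padded convolution matrix is bounded by the spectral
norm of the maximal-padding convolution matrix of the same kernel. -/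
theorem spectral_norm_zero_padded_le_maximal_padding
    (cout cin k n : ℕ) (hcout : 1 ≤ cout) (hcin : 1 ≤ cin) (hn : 1 ≤ n)
    (K : Fin cout → Fin cin → ℤ × ℤ → ℝ)
    (hK : ∀ j i s, K j i s ≠ 0 → 0 ≤ s.1 ∧ s.1 < (k:ℤ) ∧ 0 ≤ s.2 ∧ s.2 < (k:ℤ))
    (c : ℤ × ℤ) (hc : 0 ≤ c.1 ∧ c.1 < (k:ℤ) ∧ 0 ≤ c.2 ∧ c.2 < (k:ℤ))
    (T : Matrix (Fin cout × Fin n × Fin n) (Fin cin × Fin n × Fin n) ℝ)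
    (hT : ∀ (j : Fin cout) (i : Fin cin) (u u' : Fin n × Fin n),
      T (j, u) (i, u') =
        K j i (((u'.1 : ℤ) - (u.1 : ℤ) + c.1, (u'.2 : ℤ) - (u.2 : ℤ) + c.2)))
    (Tf : Matrix (Fin cout × Fin (n + k - 1) × Fin (n + k - 1)) (Fin cin × Fin n × Fin n) ℝ)
    (hTf : ∀ (j : Fin cout) (i : Fin cin) (w : Fin (n + k - 1) × Fin (n + k - 1))
        (u' : Fin n × Fin n),
      Tf (j, w) (i, u') =
        K j i (((u'.1 : ℤ) - (w.1 : ℤ) + ((k:ℤ) - 1), (u'.2 : ℤ) - (w.2 : ℤ) + ((k:ℤ) - 1)))) :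
    sigma1R T ≤ sigma1R Tf := by
  obtain ⟨h1, h2, h3, h4⟩ := hc
  obtain ⟨a, ha⟩ := Int.eq_ofNat_of_zero_le (show 0 ≤ (k:ℤ) - 1 - c.1 by omega)
  obtain ⟨b, hb⟩ := Int.eq_ofNat_of_zero_le (show 0 ≤ (k:ℤ) - 1 - c.2 by omega)
  refine sigma1R_le_of_rows T Tf
    (fun p => (p.1, (⟨p.2.1 + a, by have := p.2.1.2; omega⟩,
      ⟨p.2.2 + b, by have := p.2.2.2; omega⟩))) ?_ ?_
  · rintro ⟨j, u, v⟩ ⟨j', u', v'⟩ hh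
    simp only [Prod.mk.injEq, Fin.mk.injEq] at hh
    obtain ⟨e1, e2, e3⟩ := hh
    refine Prod.ext e1 (Prod.ext (Fin.ext ?_) (Fin.ext ?_)) <;> dsimp only <;> omega
  · rintro ⟨j, u⟩ ⟨i, u'⟩
    rw [hT, hTf]
    congr 1
    refine Prod.ext ?_ ?_ <;> push_cast <;> omega
end

section
/- Let n, c_out, c_in ≥ 1 and K ∈ ℂ^{c_out×c_in×n×n} with spatial indices in {0,…,n−1}. Let C ∈ ℂ^{c_out n² × c_in n²} be the multichannel circular convolution matrix with entries C_{(j,u,v),(i,u′,v′)} = K_{j,i,(u′−u) mod n,(v′−v) mod n}, and for a,b ∈ {0,…,n−1} let D_{a,b} ∈ ℂ^{c_out×c_in} be the matrix with entries (D_{a,b})_{j,i} = Σ_{s,t=0}^{n−1} K_{j,i,s,t} e^{−2πi(as+bt)/n}. Then σ₁(C) = max_{0≤a,b≤n−1} σ₁(D_{a,b}). -/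
open Matrix

theorem sigma1_le {m n : Type*} [Fintype m] [Fintype n] [DecidableEq n] (A : Matrix m n ℂ)
    (x : n → ℂ) : ∑ j, ‖(A *ᵥ x) j‖ ^ 2 ≤ sigma1 A ^ 2 * ∑ i, ‖x i‖ ^ 2 := by
  have h := (LinearMap.toContinuousLinearMap (Matrix.toEuclideanLin A)).le_opNorm (WithLp.toLp 2 x)
  have h2 := pow_le_pow_left₀ (norm_nonneg _) h 2
  rw [mul_pow, EuclideanSpace.norm_sq_eq, EuclideanSpace.norm_sq_eq] at h2
  exact h2

theorem sigma1_le_of {m n : Type*} [Fintype m] [Fintype n] [DecidableEq n] (A : Matrix m n ℂ)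
    (M : ℝ) (hM : 0 ≤ M)
    (h : ∀ x : n → ℂ, ∑ j, ‖(A *ᵥ x) j‖ ^ 2 ≤ M ^ 2 * ∑ i, ‖x i‖ ^ 2) : sigma1 A ≤ M := by
  refine ContinuousLinearMap.opNorm_le_bound _ hM fun x => ?_
  refine (sq_le_sq₀ (norm_nonneg _) (by positivity)).mp ?_
  rw [mul_pow, EuclideanSpace.norm_sq_eq, EuclideanSpace.norm_sq_eq]
  exact h x.ofLp

theorem sigma1_nonneg {m n : Type*} [Fintype m] [Fintype n] [DecidableEq n] (A : Matrix m n ℂ) :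
    0 ≤ sigma1 A := norm_nonneg _

open ComplexConjugate in
theorem aux_general {G J I : Type*} [AddCommGroup G] [Fintype G] [DecidableEq G]
    [Fintype J] [Fintype I] [DecidableEq I] 
    (w : G → G → ℂ) (hadd : ∀ p g h, w p (g + h) = w p g * w p h)
    (hnorm : ∀ p g, w p g * conj (w p g) = 1)
    (N : ℝ) (hN : 0 < N)
    (horth : ∀ g h, ∑ p, w p g * conj (w p h) = if g = h then (N : ℂ) else 0)
    (K : J → I → G → ℂ) (C : Matrix (J × G) (I × G) ℂ)
    (hC : ∀ j i g h, C (j, g) (i, h) = K j i (h - g))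
    (D : G → Matrix J I ℂ) (hD : ∀ p j i, D p j i = ∑ s, K j i s * w p s) :
    (∀ p, sigma1 (D p) ≤ sigma1 C) ∧
    (∀ M : ℝ, 0 ≤ M → (∀ p, sigma1 (D p) ≤ M) → sigma1 C ≤ M) := by
  have hn1 : ∀ p g, ‖w p g‖ = 1 := by
    intro p g
    have h := hnorm p g
    rw [Complex.mul_conj, Complex.normSq_eq_norm_sq] at h
    have h2 : ‖w p g‖ ^ 2 = 1 := by exact_mod_cast h
    nlinarith [norm_nonneg (w p g)]
  have hparse : ∀ x : G → ℂ, ∑ p, ‖∑ g, conj (w p g) * x g‖ ^ 2 = N * ∑ g, ‖x g‖ ^ 2 := by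
    intro x
    have : (∑ p, ((‖∑ g, conj (w p g) * x g‖ : ℝ) : ℂ) ^ 2) = N * ∑ g, (‖x g‖ : ℂ) ^ 2 := by
      simp_rw [← Complex.mul_conj', map_sum, map_mul, Complex.conj_conj, Finset.sum_mul_sum]
      rw [Finset.sum_comm, Finset.mul_sum]
      refine Finset.sum_congr rfl fun g _ => ?_
      rw [Finset.sum_comm]
      have : ∀ h, ∑ p, conj (w p g) * x g * (w p h * conj (x h))
          = (if h = g then (N : ℂ) else 0) * (x g * conj (x h)) := by
        intro h
        rw [← horth, Finset.sum_mul]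
        exact Finset.sum_congr rfl fun p _ => by ring
      simp_rw [this]
      simp
    exact_mod_cast this
  have hmul : ∀ x j g, (C *ᵥ x) (j, g) = ∑ i, ∑ h, K j i (h - g) * x (i, h) := by
    intro x j g
    simp only [mulVec, dotProduct, Fintype.sum_prod_type, hC]
  have hsplit : ∀ p g h, conj (w p g) = w p (h - g) * conj (w p h) := by
    intro p g h
    have h1 : w p h = w p (h - g) * w p g := by rw [← hadd]; simp
    calc conj (w p g) = conj (w p g) * (w p h * conj (w p h)) := by rw [hnorm, mul_one]
      _ = (w p g * conj (w p g)) * (w p (h - g) * conj (w p h)) := by rw [h1]; ring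
      _ = _ := by rw [hnorm, one_mul]
  refine ⟨fun p => ?_, fun M hM hDM => ?_⟩
  · refine sigma1_le_of _ _ (sigma1_nonneg _) fun z => ?_
    have h := sigma1_le C (fun q : I × G => w p q.2 * z q.1)
    have hy : ∀ j g, (C *ᵥ (fun q : I × G => w p q.2 * z q.1)) (j, g)
        = w p g * (D p *ᵥ z) j := by
      intro j g
      rw [hmul]
      simp only [mulVec, dotProduct, Finset.mul_sum, hD, Finset.sum_mul]
      refine Finset.sum_congr rfl fun i _ => ?_
      rw [← Equiv.sum_comp (Equiv.addRight g)]
      refine Finset.sum_congr rfl fun s _ => ?_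
      simp only [Equiv.coe_addRight, add_sub_cancel_right, hadd]
      ring
    simp only [Fintype.sum_prod_type, hy, norm_mul, hn1, one_mul, Finset.sum_const, nsmul_eq_mul,
      ← Finset.mul_sum, Finset.card_univ] at h
    have hc : (0 : ℝ) < Fintype.card G := by
      have : 0 < Fintype.card G := Fintype.card_pos_iff.mpr ⟨0⟩
      exact_mod_cast this
    refine le_of_mul_le_mul_left (h.trans (le_of_eq ?_)) hc
    ring
  · refine sigma1_le_of _ _ hM fun x => ?_
    have hy : ∀ j p, ∑ g, conj (w p g) * (C *ᵥ x) (j, g)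
        = (D p *ᵥ (fun i => ∑ h, conj (w p h) * x (i, h))) j := by
      intro j p
      simp only [hmul]
      simp only [mulVec, dotProduct, Finset.mul_sum]
      rw [Finset.sum_comm]
      refine Finset.sum_congr rfl fun i _ => ?_
      rw [Finset.sum_comm]
      refine Finset.sum_congr rfl fun h _ => ?_
      rw [hD, Finset.sum_mul, ← Equiv.sum_comp (Equiv.subLeft h)]
      refine Finset.sum_congr rfl fun g _ => ?_
      simp only [Equiv.subLeft_apply]
      rw [hsplit p (h - g) h]
      simp only [sub_sub_cancel]
      ring
    refine le_of_mul_le_mul_left ?_ hN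
    calc N * ∑ q, ‖(C *ᵥ x) q‖ ^ 2 
        = ∑ p, ∑ j, ‖(D p *ᵥ (fun i => ∑ h, conj (w p h) * x (i, h))) j‖ ^ 2 := by
          rw [Fintype.sum_prod_type, Finset.mul_sum, Finset.sum_comm]
          refine Finset.sum_congr rfl fun j _ => ?_
          rw [← hparse]
          simp only [hy]
      _ ≤ ∑ p, M ^ 2 * ∑ i, ‖∑ h, conj (w p h) * x (i, h)‖ ^ 2 := by
          refine Finset.sum_le_sum fun p _ => (sigma1_le _ _).trans ?_
          have := pow_le_pow_left₀ (sigma1_nonneg (D p)) (hDM p) 2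
          gcongr
      _ = N * (M ^ 2 * ∑ q, ‖x q‖ ^ 2) := by
          rw [← Finset.mul_sum, Finset.sum_comm]
          simp only [hparse]
          rw [Fintype.sum_prod_type, ← Finset.mul_sum]
          ring

open ComplexConjugate in
theorem aux_root (n : ℕ) [NeZero n] : ∃ e : Fin n → Fin n → ℂ,
    (∀ a s, e a s = Complex.exp (-(2 * Real.pi * Complex.I) * (((a:ℕ):ℂ) * ((s:ℕ):ℂ)) / (n:ℂ))) ∧
    (∀ a s t, e a (s + t) = e a s * e a t) ∧ (∀ a s, e a s * conj (e a s) = 1) ∧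
    (∀ s t, ∑ a, e a s * conj (e a t) = if s = t then (n : ℂ) else 0) := by
  have hn : n ≠ 0 := NeZero.ne n
  have hz := (Complex.isPrimitiveRoot_exp n hn).inv
  set ζ := (Complex.exp (2 * Real.pi * Complex.I / n))⁻¹ with hζ
  have hn1 : ‖ζ‖ = 1 := hz.norm'_eq_one hn
  have hcj : ∀ k : ℕ, ζ ^ k * conj (ζ ^ k) = 1 := by
    intro k
    rw [Complex.mul_conj']; simp [hn1]
  refine ⟨fun a s => ζ ^ ((a : ℕ) * (s : ℕ)), ?_, ?_, fun a s => hcj _, ?_⟩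
  · intro a s
    simp only [hζ]
    rw [← Complex.exp_neg, ← Complex.exp_nat_mul]
    congr 1
    push_cast
    ring
  · intro a s t
    simp only [Fin.val_add]
    rw [← pow_add, ← mul_add, mul_comm, pow_mul, ← pow_eq_pow_mod _ hz.pow_eq_one, ← pow_mul,
      mul_comm]
  · intro s t
    split_ifs with h
    · subst h
      simp [hcj, -map_pow]
    · set μ := ζ ^ (s : ℕ) * conj (ζ ^ (t : ℕ)) with hμ
      have h1 : μ ≠ 1 := by
        intro h1
        apply h
        apply Fin.ext
        apply hz.pow_inj s.2 t.2
        calc ζ ^ (s : ℕ) = ζ ^ (s : ℕ) * (ζ ^ (t : ℕ) * conj (ζ ^ (t : ℕ))) := by rw [hcj, mul_one]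
          _ = μ * ζ ^ (t : ℕ) := by rw [hμ]; ring
          _ = _ := by rw [h1, one_mul]
      have h2 : μ ^ n = 1 := by
        rw [hμ, mul_pow, ← map_pow, ← pow_mul, ← pow_mul, mul_comm, mul_comm (t : ℕ), 
          mul_comm (s : ℕ), pow_mul, pow_mul, hz.pow_eq_one]
        simp
      have h3 : ∀ a : Fin n, ζ ^ ((a : ℕ) * (s : ℕ)) * conj (ζ ^ ((a : ℕ) * (t : ℕ))) 
          = μ ^ (a : ℕ) := by
        intro a
        rw [hμ, mul_pow, ← map_pow, ← pow_mul, ← pow_mul, mul_comm (a : ℕ), mul_comm (a : ℕ)]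
      simp only [h3]
      rw [Fin.sum_univ_eq_sum_range (fun a => μ ^ a)]
      have h4 := mul_geom_sum μ n
      rw [h2, sub_self] at h4
      exact (mul_eq_zero.mp h4).resolve_left (sub_ne_zero.mpr h1)

/-- The spectral norm of a multichannel circular convolution matrix equals the maximum of the
spectral norms of its Fourier-domain `c_out × c_in` blocks. -/
theorem spectral_norm_circular_conv_eq_max_fourier_blocks
    (n cout cin : ℕ) (hn : 1 ≤ n) (hcout : 1 ≤ cout) (hcin : 1 ≤ cin)
    (K : Fin cout → Fin cin → Fin n → Fin n → ℂ)
    (C : Matrix (Fin cout × Fin n × Fin n) (Fin cin × Fin n × Fin n) ℂ)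
    (hC : ∀ (j : Fin cout) (i : Fin cin) (u v u' v' : Fin n),
      C (j, (u, v)) (i, (u', v')) = K j i (u' - u) (v' - v))
    (D : Fin n → Fin n → Matrix (Fin cout) (Fin cin) ℂ)
    (hD : ∀ (a b : Fin n) (j : Fin cout) (i : Fin cin),
      D a b j i = ∑ s : Fin n, ∑ t : Fin n,
        K j i s t * Complex.exp (-(2 * Real.pi * Complex.I) *
          (((a:ℕ):ℂ) * ((s:ℕ):ℂ) + ((b:ℕ):ℂ) * ((t:ℕ):ℂ)) / (n:ℂ))) :
    sigma1 C = ⨆ a : Fin n, ⨆ b : Fin n, sigma1 (D a b) := by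
  haveI : NeZero n := ⟨by omega⟩
  obtain ⟨e, he, hadd, hnorm, horth⟩ := aux_root n
  have key := aux_general (G := Fin n × Fin n) (fun p g => e p.1 g.1 * e p.2 g.2)
    (by intro p g h; simp only [Prod.fst_add, Prod.snd_add, hadd]; ring)
    (by 
      intro p g
      rw [map_mul, mul_mul_mul_comm, hnorm, hnorm, one_mul])
    ((n : ℝ) ^ 2) (by have : (0 : ℝ) < n := by exact_mod_cast hn
                      positivity)
    (by
      rintro ⟨s, t⟩ ⟨s', t'⟩
      simp only [map_mul, Fintype.sum_prod_type]
      simp_rw [mul_mul_mul_comm (e _ s) (e _ t)]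
      rw [← Finset.sum_mul_sum, horth, horth]
      by_cases h1 : s = s' <;> by_cases h2 : t = t' <;> simp [h1, h2, sq])
    (fun j i g => K j i g.1 g.2) C
    (by rintro j i ⟨u, v⟩ ⟨u', v'⟩; exact hC _ _ _ _ _ _)
    (fun p => D p.1 p.2)
    (by
      intro p j i
      simp only [hD, Fintype.sum_prod_type]
      refine Finset.sum_congr rfl fun s _ => Finset.sum_congr rfl fun t _ => ?_
      rw [he, he, ← Complex.exp_add]
      congr 2
      ring)
  have hb : ∀ a, BddAbove (Set.range fun b => sigma1 (D a b)) := fun a => Set.finite_range _ |>.bddAbove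
  have hb2 : BddAbove (Set.range fun a => ⨆ b, sigma1 (D a b)) := Set.finite_range _ |>.bddAbove
  apply le_antisymm
  · refine key.2 _ ?_ ?_
    · exact Real.iSup_nonneg fun a => Real.iSup_nonneg fun b => sigma1_nonneg _
    · intro p
      exact (le_ciSup (hb p.1) p.2).trans (le_ciSup hb2 p.1)
  · exact ciSup_le fun a => ciSup_le fun b => key.1 (a, b)
end

section
/- Let W ∈ ℝ^{p×q}. For a natural number t ≥ 0, set G_t = (Wᵀ W)^{2^t} ∈ ℝ^{q×q}, and let R_t ∈ ℝ^{q×q} be the diagonal matrix with (R_t)_{ii} = ( Σ_{j=1}^{q} |(G_t)_{ij}| )^{-2^{-(t+1)}} when Σ_j |(G_t)_{ij}| > 0, and (R_t)_{ii} = 0 otherwise. Then σ₁(W R_t) ≤ 1 for every t ≥ 0. -/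
open Matrix

lemma sr_quad_sq {n : Type*} [Fintype n] [DecidableEq n] {A : Matrix n n ℝ}
    (hA : A.IsHermitian) (x : n → ℝ) :
    x ⬝ᵥ ((A ^ 2) *ᵥ x) = (A *ᵥ x) ⬝ᵥ (A *ᵥ x) := by
  have h : Aᵀ = A := by simpa [Matrix.IsHermitian] using hA
  rw [pow_two, ← Matrix.mulVec_mulVec, Matrix.dotProduct_mulVec, ← Matrix.mulVec_transpose, h]

lemma sr_sqrt_mono {n : Type*} [Fintype n] [DecidableEq n] {A B : Matrix n n ℝ}
    (hA : A.IsHermitian) (hB : B.PosSemidef) (h : (B ^ 2 - A ^ 2).PosSemidef) :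
    (B - A).PosSemidef := by
  have hC : (B - A).IsHermitian := hB.1.sub hA
  rw [hC.posSemidef_iff_eigenvalues_nonneg]
  intro i
  by_contra hneg
  simp only [Pi.zero_apply, not_le] at hneg
  have hv := hC.mulVec_eigenvectorBasis i
  have hnorm : ‖hC.eigenvectorBasis i‖ ^ 2 = 1 := by
    rw [hC.eigenvectorBasis.orthonormal.1 i]; norm_num
  rw [EuclideanSpace.real_norm_sq_eq] at hnorm
  generalize hC.eigenvalues i = μ at *
  generalize hw : hC.eigenvectorBasis i = w at *
  set x : n → ℝ := w.ofLp with hx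
  have hxx : x ⬝ᵥ x = 1 := by
    rw [← hnorm]; simp [dotProduct, pow_two]
  have hAx : A *ᵥ x = B *ᵥ x - μ • x := by
    rw [← hv, Matrix.sub_mulVec]; abel
  have h1 := h.dotProduct_mulVec_nonneg x
  have h2 := hB.dotProduct_mulVec_nonneg x
  simp only [star_trivial] at h1 h2
  rw [Matrix.sub_mulVec, dotProduct_sub, sr_quad_sq hA, sr_quad_sq hB.1, hAx] at h1
  simp only [sub_dotProduct, dotProduct_sub, smul_dotProduct, dotProduct_smul, smul_eq_mul,
    hxx, dotProduct_comm (B *ᵥ x) x] at h1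
  nlinarith [mul_nonneg (neg_nonneg.2 hneg.le) h2, mul_pos_of_neg_of_neg hneg hneg]

lemma sr_root_mono {n : Type*} [Fintype n] [DecidableEq n] (t : ℕ) {A B : Matrix n n ℝ}
    (hA : A.PosSemidef) (hB : B.PosSemidef) (h : (B ^ (2 ^ t) - A ^ (2 ^ t)).PosSemidef) :
    (B - A).PosSemidef := by
  induction t with
  | zero => simpa using h
  | succ t ih =>
    apply ih
    rw [pow_succ, pow_mul, pow_mul] at h
    exact sr_sqrt_mono (hA.pow _).1 (hB.pow _) h

lemma sr_dominant {n : Type*} [Fintype n] [DecidableEq n] {G : Matrix n n ℝ}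
    (hG : G.IsHermitian) :
    (Matrix.diagonal (fun i => ∑ j, |G i j|) - G).PosSemidef := by
  have hs : ∀ i j, G i j = G j i := fun i j => by simpa using (hG.apply i j).symm
  refine .of_dotProduct_mulVec_nonneg ((Matrix.isHermitian_diagonal _).sub hG) fun x => ?_
  rw [star_trivial, Matrix.sub_mulVec, dotProduct_sub, sub_nonneg]
  have e1 : x ⬝ᵥ (G *ᵥ x) = ∑ i, ∑ j, G i j * (x i * x j) := by
    simp only [dotProduct, mulVec, Finset.mul_sum]
    refine Finset.sum_congr rfl fun i _ => Finset.sum_congr rfl fun j _ => by ring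
  have e2 : x ⬝ᵥ (Matrix.diagonal (fun i => ∑ j, |G i j|) *ᵥ x)
      = ∑ i, ∑ j, |G i j| * x i ^ 2 := by
    simp only [dotProduct, mulVec_diagonal, Finset.sum_mul, Finset.mul_sum]
    refine Finset.sum_congr rfl fun i _ => Finset.sum_congr rfl fun j _ => by ring
  have e3 : ∑ i, ∑ j, |G i j| * x i ^ 2 = ∑ i, ∑ j, |G i j| * x j ^ 2 := by
    rw [Finset.sum_comm]
    refine Finset.sum_congr rfl fun i _ => Finset.sum_congr rfl fun j _ => by rw [hs]
  have e4 : ∑ i, ∑ j, G i j * (x i * x j)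
      ≤ ∑ i, ∑ j, (|G i j| * x i ^ 2 + |G i j| * x j ^ 2) / 2 := by
    refine Finset.sum_le_sum fun i _ => Finset.sum_le_sum fun j _ => ?_
    have a1 : G i j * (x i * x j) ≤ |G i j| * |x i * x j| := by
      rw [← abs_mul]; exact le_abs_self _
    have a2 : |x i * x j| ≤ (x i ^ 2 + x j ^ 2) / 2 := by
      rw [abs_le]; constructor <;> nlinarith [sq_nonneg (x i - x j), sq_nonneg (x i + x j)]
    nlinarith [mul_le_mul_of_nonneg_left a2 (abs_nonneg (G i j))]
  simp only [← Finset.sum_div, Finset.sum_add_distrib] at e4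
  rw [e1, e2]
  linarith

/-- Spectral rescaling upper-bound: the matrix `W` rescaled by the diagonal matrix `R_t` built
from the absolute row sums of the Gram iterate `(Wᵀ W)^(2^t)` has spectral norm at most `1`. -/
theorem spectral_rescaling_norm_le_one
    (p q : ℕ) (W : Matrix (Fin p) (Fin q) ℝ)
    (G : ℕ → Matrix (Fin q) (Fin q) ℝ)
    (hG : ∀ t : ℕ, G t = (Wᵀ * W) ^ (2 ^ t))
    (R : ℕ → Matrix (Fin q) (Fin q) ℝ)
    (hR : ∀ t : ℕ, R t = Matrix.diagonal (fun i : Fin q =>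
      if 0 < ∑ j : Fin q, |G t i j| then
        (∑ j : Fin q, |G t i j|) ^ (-((2:ℝ) ^ (-((t:ℝ) + 1))))
      else (0:ℝ))) :
    ∀ t : ℕ, sigma1R (W * R t) ≤ 1 := by
  intro t
  set A : Matrix (Fin q) (Fin q) ℝ := Wᵀ * W with hAdef
  have hA : A.PosSemidef := by
    simpa using Matrix.posSemidef_conjTranspose_mul_self W
  set d : Fin q → ℝ := fun i => ∑ j, |G t i j| with hd
  have hd0 : ∀ i, 0 ≤ d i := fun i => Finset.sum_nonneg fun j _ => abs_nonneg _
  set e : Fin q → ℝ := fun i => d i ^ ((2:ℝ) ^ (-(t:ℝ))) with he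
  have he0 : ∀ i, 0 ≤ e i := fun i => Real.rpow_nonneg (hd0 i) _
  have hpow : ∀ i, e i ^ (2 ^ t) = d i := by
    intro i
    rw [he]
    simp only
    rw [← Real.rpow_natCast, ← Real.rpow_mul (hd0 i)]
    have : (2:ℝ) ^ (-(t:ℝ)) * ((2 ^ t : ℕ) : ℝ) = 1 := by
      push_cast
      rw [← Real.rpow_natCast 2 t, ← Real.rpow_add (by norm_num)]
      simp
    rw [this, Real.rpow_one]
  have hdom : (Matrix.diagonal e ^ (2 ^ t) - A ^ (2 ^ t)).PosSemidef := by
    have h := sr_dominant (G := G t) (by rw [hG]; exact (hA.pow _).1)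
    rw [Matrix.diagonal_pow]
    have : e ^ (2 ^ t) = d := by
      funext i; exact hpow i
    rw [this, ← hG t]
    exact h
  have hle := sr_root_mono t hA (Matrix.PosSemidef.diagonal he0) hdom
  set r : Fin q → ℝ := fun i =>
    if 0 < d i then d i ^ (-((2:ℝ) ^ (-((t:ℝ) + 1)))) else (0:ℝ) with hr
  have hRt : R t = Matrix.diagonal r := hR t
  have her : ∀ i, e i * r i ^ 2 ≤ 1 := by
    intro i
    by_cases h : 0 < d i
    · have h1 : r i = d i ^ (-((2:ℝ) ^ (-((t:ℝ) + 1)))) := by simp [hr, h]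
      rw [h1, he]
      simp only
      rw [pow_two, ← Real.rpow_add h, ← Real.rpow_add h]
      have : (2:ℝ) ^ (-(t:ℝ)) = 2 * (2:ℝ) ^ (-((t:ℝ) + 1)) := by
        have h2 : -(t:ℝ) = 1 + (-((t:ℝ) + 1)) := by ring
        conv_lhs => rw [h2]
        rw [Real.rpow_add (by norm_num), Real.rpow_one]
      rw [this]
      ring_nf
      simp
    · have h1 : r i = 0 := by simp [hr, h]
      rw [h1]; norm_num
  unfold sigma1R
  refine ContinuousLinearMap.opNorm_le_bound _ zero_le_one fun x => ?_
  rw [one_mul]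
  refine le_of_sq_le_sq ?_ (norm_nonneg _)
  rw [EuclideanSpace.real_norm_sq_eq, EuclideanSpace.real_norm_sq_eq]
  set y : Fin q → ℝ := R t *ᵥ x.ofLp with hy
  have hyi : ∀ i, y i = r i * x.ofLp i := by
    intro i; rw [hy, hRt, mulVec_diagonal]
  have hq := hle.dotProduct_mulVec_nonneg y
  rw [star_trivial, Matrix.sub_mulVec, dotProduct_sub, sub_nonneg] at hq
  have e1 : y ⬝ᵥ (A *ᵥ y) = (W *ᵥ y) ⬝ᵥ (W *ᵥ y) := by
    rw [hAdef, ← Matrix.mulVec_mulVec, Matrix.dotProduct_mulVec, Matrix.vecMul_transpose]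
  rw [e1] at hq
  calc _ = (W *ᵥ y) ⬝ᵥ (W *ᵥ y) := by
        simp only [LinearMap.coe_toContinuousLinearMap', Matrix.ofLp_toEuclideanLin_apply,
          ← Matrix.mulVec_mulVec, ← hy, dotProduct, pow_two]
    _ ≤ _ := hq
    _ ≤ _ := by
        simp only [dotProduct, mulVec_diagonal, hyi]
        refine Finset.sum_le_sum fun i _ => ?_
        nlinarith [mul_le_mul_of_nonneg_right (her i) (sq_nonneg (x.ofLp i))]
end

section
/- Let W ∈ ℝ^{p×q} and let d₁,…,d_q > 0 be positive reals. For a natural number t ≥ 0, set G_t = (Wᵀ W)^{2^t} ∈ ℝ^{q×q}. Then the matrix Δ_t − WᵀW is positive semidefinite, where Δ_t ∈ ℝ^{q×q} is the diagonal matrix with (Δ_t)_{ii} = ( Σ_{j=1}^{q} |(G_t)_{ij}| · d_j/d_i )^{2^{-t}}. -/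
open Matrix

lemma aux_base {q : ℕ} (G : Matrix (Fin q) (Fin q) ℝ) (hG : G.IsHermitian)
    (d : Fin q → ℝ) (hd : ∀ i, 0 < d i) :
    (Matrix.diagonal (fun i : Fin q => ∑ j : Fin q, |G i j| * d j / d i) - G).PosSemidef := by
  refine Matrix.PosSemidef.of_dotProduct_mulVec_nonneg
    ((Matrix.isHermitian_diagonal _).sub hG) ?_
  intro x
  have hs : ∀ i j, G j i = G i j := fun i j => by simpa using hG.apply i j
  have e : star x ⬝ᵥ ((Matrix.diagonal (fun i : Fin q => ∑ j : Fin q, |G i j| * d j / d i) - G) *ᵥ x)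
      = ∑ i, ∑ j, (|G i j| * d j / d i * x i ^ 2 - G i j * x i * x j) := by
    simp only [Matrix.sub_mulVec, dotProduct, Pi.sub_apply, Matrix.mulVec_diagonal, star_trivial]
    refine Finset.sum_congr rfl fun i _ => ?_
    rw [Finset.sum_sub_distrib, mul_sub, ← Finset.sum_mul]
    congr 1
    · ring
    · rw [mulVec, dotProduct, Finset.mul_sum]
      exact Finset.sum_congr rfl fun j _ => by ring
  rw [e]
  have e2 : ∑ i, ∑ j, (|G i j| * d j / d i * x i ^ 2 - G i j * x i * x j)
      = ∑ i, ∑ j, (|G i j| * d i / d j * x j ^ 2 - G i j * x i * x j) := by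
    rw [Finset.sum_comm]
    refine Finset.sum_congr rfl fun i _ => Finset.sum_congr rfl fun j _ => ?_
    rw [hs i j]; ring
  have e3 : 0 ≤ ∑ i, ∑ j, (|G i j| * d j / d i * x i ^ 2 - G i j * x i * x j)
      + ∑ i, ∑ j, (|G i j| * d i / d j * x j ^ 2 - G i j * x i * x j) := by
    simp only [← Finset.sum_add_distrib]
    refine Finset.sum_nonneg fun i _ => Finset.sum_nonneg fun j _ => ?_
    have hi := hd i
    have hj := hd j
    have h1 : |G i j| * d j / d i * x i ^ 2 + |G i j| * d i / d j * x j ^ 2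
        - 2 * (|G i j| * |x i| * |x j|)
        = |G i j| * (d j * |x i| - d i * |x j|) ^ 2 / (d i * d j) := by
      rw [← sq_abs (x i), ← sq_abs (x j)]
      field_simp
      ring
    have h2 : 0 ≤ |G i j| * (d j * |x i| - d i * |x j|) ^ 2 / (d i * d j) := by positivity
    have h3 : G i j * x i * x j ≤ |G i j| * |x i| * |x j| := by
      rw [← abs_mul, ← abs_mul]; exact le_abs_self _
    linarith
  linarith

lemma aux_sqrt {q : ℕ} (A D : Matrix (Fin q) (Fin q) ℝ) (hA : A.IsHermitian)
    (hD : D.PosSemidef) (h : (D ^ 2 - A ^ 2).PosSemidef) : (D - A).PosSemidef := by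
  have hH : (D - A).IsHermitian := hD.isHermitian.sub hA
  rw [hH.posSemidef_iff_eigenvalues_nonneg]
  intro i
  by_contra hlt
  have hl : hH.eigenvalues i < 0 := by simpa using hlt
  have hv := hH.mulVec_eigenvectorBasis i
  have hv0 : ((hH.eigenvectorBasis i) : Fin q → ℝ) ≠ 0 := by
    intro h0
    apply hH.eigenvectorBasis.orthonormal.ne_zero i
    ext j
    exact congrFun h0 j
  generalize hH.eigenvalues i = l at *
  generalize ((hH.eigenvectorBasis i) : Fin q → ℝ) = v at *
  have hAv : A *ᵥ v = D *ᵥ v - l • v := by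
    rw [← hv, Matrix.sub_mulVec]; simp
  have h1 := h.dotProduct_mulVec_nonneg v
  have h2 := hD.dotProduct_mulVec_nonneg v
  have key : ∀ B : Matrix (Fin q) (Fin q) ℝ, B.IsHermitian →
      v ⬝ᵥ (B ^ 2 *ᵥ v) = (B *ᵥ v) ⬝ᵥ (B *ᵥ v) := by
    intro B hB
    have hB' : Bᵀ = B := by simpa using hB.eq
    rw [pow_two, ← Matrix.mulVec_mulVec, Matrix.dotProduct_mulVec, ← Matrix.mulVec_transpose, hB']
  rw [star_trivial] at h1 h2
  rw [Matrix.sub_mulVec, dotProduct_sub, key D hD.isHermitian, key A hA, hAv] at h1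
  simp only [sub_dotProduct, dotProduct_sub, smul_dotProduct, dotProduct_smul, smul_eq_mul] at h1
  rw [dotProduct_comm (D *ᵥ v) v] at h1
  have h3 : 0 < v ⬝ᵥ v := by
    have := dotProduct_star_self_pos_iff.mpr hv0
    simpa using this
  nlinarith [mul_nonneg (neg_nonneg.mpr hl.le) h2, mul_pos (mul_pos_of_neg_of_neg hl hl) h3]

lemma aux_ind {q : ℕ} (S : Matrix (Fin q) (Fin q) ℝ) (hS : S.IsHermitian) (t : ℕ) :
    ∀ f : Fin q → ℝ, (∀ i, 0 ≤ f i) → (Matrix.diagonal f - S ^ (2 ^ t)).PosSemidef →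
    (Matrix.diagonal (fun i => f i ^ ((2:ℝ) ^ (-(t:ℝ)))) - S).PosSemidef := by
  induction t with
  | zero => intro f hf h; simpa using h
  | succ t ih =>
    intro f hf h
    have h1 := ih (fun i => √(f i)) (fun i => Real.sqrt_nonneg _) (by
      refine aux_sqrt _ _ (hS.pow _) (Matrix.PosSemidef.diagonal fun i => Real.sqrt_nonneg _) ?_
      rw [Matrix.diagonal_pow, ← pow_mul, ← pow_succ]
      have e : (fun i => √(f i)) ^ 2 = f := by
        ext i
        simp [Real.sq_sqrt (hf i)]
      rw [e]
      exact h)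
    suffices e : (fun i => f i ^ ((2:ℝ) ^ (-((t + 1 : ℕ):ℝ))))
        = fun i => √(f i) ^ ((2:ℝ) ^ (-(t:ℝ))) by
      rw [e]
      exact h1
    ext i
    rw [Real.sqrt_eq_rpow, ← Real.rpow_mul (hf i)]
    congr 1
    push_cast
    rw [neg_add, Real.rpow_add two_pos, Real.rpow_neg_one]
    ring


/-- Weighted spectral rescaling PSD inequality: `Wᵀ W` is dominated (in the Loewner order) by
the diagonal matrix of `2⁻ᵗ`-th powers of the weighted absolute row sums of the Gram iterate
`(Wᵀ W)^(2^t)`. -/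
theorem weighted_gram_iterate_diagonal_dominates
    (p q : ℕ) (W : Matrix (Fin p) (Fin q) ℝ)
    (d : Fin q → ℝ) (hd : ∀ i, 0 < d i)
    (t : ℕ)
    (G : Matrix (Fin q) (Fin q) ℝ) (hG : G = (Wᵀ * W) ^ (2 ^ t))
    (Δ : Matrix (Fin q) (Fin q) ℝ)
    (hΔ : Δ = Matrix.diagonal (fun i : Fin q =>
      (∑ j : Fin q, |G i j| * d j / d i) ^ ((2:ℝ) ^ (-(t:ℝ))))) :
    (Δ - Wᵀ * W).PosSemidef := by
  have hS : (Wᵀ * W).IsHermitian := by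
    simpa using Matrix.isHermitian_conjTranspose_mul_self W
  subst hΔ
  subst hG
  refine aux_ind _ hS t _ ?_ (aux_base _ (hS.pow _) d hd)
  intro i
  refine Finset.sum_nonneg fun j _ => ?_
  have := hd i
  have := hd j
  positivity
end

section
/- Let W ∈ ℝ^{p×q}, b ∈ ℝ^q, and d₁,…,d_q > 0. For a natural number t ≥ 0, set G_t = (Wᵀ W)^{2^t} ∈ ℝ^{q×q} and let R_t ∈ ℝ^{q×q} be the diagonal matrix with (R_t)_{ii} = ( Σ_{j=1}^{q} |(G_t)_{ij}| · d_j/d_i )^{-2^{-(t+1)}} when Σ_j |(G_t)_{ij}| d_j/d_i > 0, and (R_t)_{ii} = 0 otherwise. Then the affine map x ↦ W R_t x + b from ℝ^q to ℝ^p is 1-Lipschitz for the ℓ₂ norms: ‖W R_t x − W R_t y‖₂ ≤ ‖x − y‖₂ for all x, y ∈ ℝ^q. Equivalently, σ₁(W R_t) ≤ 1. -/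
open Matrix

/-- The Euclidean (ℓ₂) norm of a finitely indexed real vector. -/
noncomputable def l2norm {n : Type*} [Fintype n] (x : n → ℝ) : ℝ :=
  Real.sqrt (∑ i, (x i) ^ 2)

lemma wsr_sqrt_mono {n : Type*} [Fintype n] [DecidableEq n] {A B : Matrix n n ℝ}
    (hA : A.PosSemidef) (hB : B.PosSemidef) (h : (B * B - A * A).PosSemidef) :
    (B - A).PosSemidef := by
  have hH : (B - A).IsHermitian := hB.1.sub hA.1
  rw [hH.posSemidef_iff_eigenvalues_nonneg]
  intro i
  by_contra hneg
  simp only [Pi.zero_apply, not_le] at hneg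
  have hv := hH.mulVec_eigenvectorBasis i
  set l := hH.eigenvalues i with hl
  have hv0 : (hH.eigenvectorBasis i).ofLp ≠ 0 := by
    intro h0
    have := hH.eigenvectorBasis.orthonormal.ne_zero i
    exact this (by ext j; exact congrFun h0 j)
  generalize (hH.eigenvectorBasis i).ofLp = v at hv hv0
  have hAT : Aᵀ = A := by simpa using hA.1.eq
  have hBT : Bᵀ = B := by simpa using hB.1.eq
  have h1 := h.dotProduct_mulVec_nonneg v
  have h2 := hB.dotProduct_mulVec_nonneg v
  have hAv : A *ᵥ v = B *ᵥ v - l • v := by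
    rw [Matrix.sub_mulVec] at hv
    rw [← hv]; abel
  have key : ∀ M : Matrix n n ℝ, Mᵀ = M → v ⬝ᵥ ((M * M) *ᵥ v) = (M *ᵥ v) ⬝ᵥ (M *ᵥ v) := by
    intro M hM
    rw [← Matrix.mulVec_mulVec, Matrix.dotProduct_mulVec, ← Matrix.mulVec_transpose, hM]
  simp only [star_trivial] at h1 h2
  rw [Matrix.sub_mulVec, dotProduct_sub, key _ hAT, key _ hBT, hAv] at h1
  simp only [sub_dotProduct, dotProduct_sub, smul_dotProduct, dotProduct_smul, smul_eq_mul] at h1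
  rw [dotProduct_comm (B *ᵥ v) v] at h1
  have h3 : 0 < v ⬝ᵥ v := by
    have := Matrix.dotProduct_star_self_pos_iff.2 hv0
    simpa using this
  nlinarith [mul_pos (mul_pos_of_neg_of_neg hneg hneg) h3, mul_nonneg (neg_nonneg.2 hneg.le) h2]

lemma wsr_root_mono {n : Type*} [Fintype n] [DecidableEq n] {A : Matrix n n ℝ}
    (hA : A.PosSemidef) (e : n → ℝ) (he : ∀ i, 0 ≤ e i) (t : ℕ)
    (h : (Matrix.diagonal e ^ (2 ^ t) - A ^ (2 ^ t)).PosSemidef) :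
    (Matrix.diagonal e - A).PosSemidef := by
  have hE : (Matrix.diagonal e).PosSemidef := Matrix.PosSemidef.diagonal he
  induction t with
  | zero => simpa using h
  | succ t ih =>
    apply ih
    apply wsr_sqrt_mono (hA.pow _) (hE.pow _)
    rw [← pow_add, ← pow_add, ← two_mul, ← pow_succ']
    exact h

lemma wsr_gersh {q : ℕ} (G : Matrix (Fin q) (Fin q) ℝ) (hG : G.IsHermitian)
    (d : Fin q → ℝ) (hd : ∀ i, 0 < d i) :
    (Matrix.diagonal (fun i => ∑ j, |G i j| * d j / d i) - G).PosSemidef := by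
  refine Matrix.PosSemidef.of_dotProduct_mulVec_nonneg
    ((Matrix.isHermitian_diagonal _).sub hG) ?_
  intro x
  have hs : ∀ i j, G i j = G j i := fun i j => by simpa using (hG.apply i j).symm
  rw [Matrix.sub_mulVec, dotProduct_sub, sub_nonneg]
  simp only [star_trivial, dotProduct, Matrix.mulVec_diagonal]
  simp only [Matrix.mulVec, dotProduct]
  have e1 : ∑ i, x i * ((∑ j, |G i j| * d j / d i) * x i)
      = ∑ i, ∑ j, |G i j| * (d j / d i * x i ^ 2) := by
    refine Finset.sum_congr rfl fun i _ => ?_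
    rw [Finset.sum_mul, Finset.mul_sum]
    refine Finset.sum_congr rfl fun j _ => ?_
    ring
  have e2 : ∑ i, ∑ j, |G i j| * (d j / d i * x i ^ 2)
      = ∑ i, ∑ j, |G i j| * (d i / d j * x j ^ 2) := by
    rw [Finset.sum_comm]
    refine Finset.sum_congr rfl fun i _ => Finset.sum_congr rfl fun j _ => ?_
    rw [hs]
  have e3 : 2 * ∑ i, x i * ∑ j, G i j * x j ≤
      ∑ i, ∑ j, |G i j| * (d j / d i * x i ^ 2) + ∑ i, ∑ j, |G i j| * (d i / d j * x j ^ 2) := by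
    rw [← Finset.sum_add_distrib, Finset.mul_sum]
    refine Finset.sum_le_sum fun i _ => ?_
    rw [← Finset.sum_add_distrib, Finset.mul_sum, Finset.mul_sum]
    refine Finset.sum_le_sum fun j _ => ?_
    have hdi := hd i
    have hdj := hd j
    have a1 : 2 * (|x i| * |x j|) ≤ d j / d i * x i ^ 2 + d i / d j * x j ^ 2 := by
      have : d j / d i * x i ^ 2 + d i / d j * x j ^ 2 - 2 * (|x i| * |x j|)
          = (d j * |x i| - d i * |x j|) ^ 2 / (d i * d j) := by
        rw [← sq_abs (x i), ← sq_abs (x j)]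
        field_simp
        ring
      have h0 : 0 ≤ (d j * |x i| - d i * |x j|) ^ 2 / (d i * d j) := by positivity
      linarith
    have a2 : x i * (G i j * x j) ≤ |G i j| * (|x i| * |x j|) := by
      refine (le_abs_self _).trans (le_of_eq ?_)
      rw [abs_mul, abs_mul]; ring
    nlinarith [mul_le_mul_of_nonneg_left a1 (abs_nonneg (G i j))]
  linarith

/-- The dense layer `x ↦ W R_t x + b` built from the weighted spectral rescaling `R_t` is
`1`-Lipschitz for the ℓ₂ norms; equivalently `σ₁(W R_t) ≤ 1`. -/
theorem weighted_spectral_rescaling_dense_layer_one_lipschitz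
    (p q : ℕ) (W : Matrix (Fin p) (Fin q) ℝ) (b : Fin p → ℝ)
    (d : Fin q → ℝ) (hd : ∀ i, 0 < d i)
    (t : ℕ)
    (G : Matrix (Fin q) (Fin q) ℝ) (hG : G = (Wᵀ * W) ^ (2 ^ t))
    (R : Matrix (Fin q) (Fin q) ℝ)
    (hR : R = Matrix.diagonal (fun i : Fin q =>
      if 0 < ∑ j : Fin q, |G i j| * d j / d i then
        (∑ j : Fin q, |G i j| * d j / d i) ^ (-((2:ℝ) ^ (-((t:ℝ) + 1))))
      else (0:ℝ))) :
    (∀ x y : Fin q → ℝ,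
        l2norm (((W * R).mulVec x + b) - ((W * R).mulVec y + b)) ≤ l2norm (x - y)) ∧
      sigma1R (W * R) ≤ 1 := by
  have hA : (Wᵀ * W).PosSemidef := by
    simpa using Matrix.posSemidef_conjTranspose_mul_self W
  have hGH : G.IsHermitian := hG ▸ (hA.pow _).1
  have hg := wsr_gersh G hGH d hd
  have hs0 : ∀ i, 0 ≤ ∑ j : Fin q, |G i j| * d j / d i := fun i =>
    Finset.sum_nonneg fun j _ => by
      have := hd i
      have := hd j
      positivity
  obtain ⟨s, hs⟩ : ∃ s : Fin q → ℝ, s = fun i => ∑ j : Fin q, |G i j| * d j / d i := ⟨_, rfl⟩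
  have hsi : ∀ i, ∑ j : Fin q, |G i j| * d j / d i = s i := fun i => by rw [hs]
  simp only [hsi] at hg hs0 hR
  set r : Fin q → ℝ := fun i => if 0 < s i then (s i) ^ (-((2:ℝ) ^ (-((t:ℝ) + 1)))) else 0 with hr
  set e : Fin q → ℝ := fun i => (s i) ^ (((2 ^ t : ℕ) : ℝ)⁻¹) with he
  have he0 : ∀ i, 0 ≤ e i := fun i => Real.rpow_nonneg (hs0 i) _
  have hes : ∀ i, e i ^ (2 ^ t) = s i := fun i =>
    Real.rpow_inv_natCast_pow (hs0 i) (by positivity)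
  have hroot : (Matrix.diagonal e - Wᵀ * W).PosSemidef := by
    apply wsr_root_mono hA e he0 t
    rw [Matrix.diagonal_pow, ← hG]
    have : e ^ (2 ^ t) = s := funext hes
    rw [this]
    exact hg
  have her : ∀ i, e i * r i ^ 2 ≤ 1 := by
    intro i
    simp only [hr, he]
    split_ifs with h
    · apply le_of_eq
      rw [← Real.rpow_natCast, ← Real.rpow_mul h.le, ← Real.rpow_add h]
      have : (((2 ^ t : ℕ) : ℝ)⁻¹ + -(2:ℝ) ^ (-((t:ℝ) + 1)) * ((2 : ℕ) : ℝ)) = 0 := by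
        rw [Real.rpow_neg (by norm_num), Real.rpow_add (by norm_num), Real.rpow_natCast]
        push_cast
        rw [Real.rpow_one]
        field_simp
        ring
      rw [this, Real.rpow_zero]
    · simp
  have main : ∀ x : Fin q → ℝ, ∑ i, ((W * R).mulVec x i) ^ 2 ≤ ∑ i, x i ^ 2 := by
    intro x
    have h1 := hroot.dotProduct_mulVec_nonneg (R *ᵥ x)
    rw [Matrix.sub_mulVec, dotProduct_sub, sub_nonneg, star_trivial, ← Matrix.mulVec_mulVec,
      Matrix.dotProduct_mulVec _ Wᵀ, Matrix.vecMul_transpose, Matrix.mulVec_mulVec, hR] at h1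
    simp only [dotProduct, Matrix.mulVec_diagonal] at h1
    rw [hR]
    calc _ = ∑ i, ((W * Matrix.diagonal r).mulVec x i) * ((W * Matrix.diagonal r).mulVec x i) :=
          Finset.sum_congr rfl fun i _ => sq _
      _ ≤ _ := h1
      _ ≤ _ := Finset.sum_le_sum fun i _ => by
          nlinarith [mul_le_mul_of_nonneg_right (her i) (sq_nonneg (x i))]
  constructor
  · intro x y
    rw [add_sub_add_right_eq_sub, ← Matrix.mulVec_sub]
    exact Real.sqrt_le_sqrt (main (x - y))
  · refine ContinuousLinearMap.opNorm_le_bound _ zero_le_one fun x => ?_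
    rw [one_mul, EuclideanSpace.norm_eq, EuclideanSpace.norm_eq]
    apply Real.sqrt_le_sqrt
    simpa using main x.ofLp
end

section
/- Let W ∈ ℝ^{p×q}, b ∈ ℝ^q, and d₁,…,d_q > 0. For a natural number t ≥ 0, set G_t = (Wᵀ W)^{2^t} ∈ ℝ^{q×q} and let R_t ∈ ℝ^{q×q} be the diagonal matrix with (R_t)_{ii} = ( Σ_{j=1}^{q} |(G_t)_{ij}| · d_j/d_i )^{-2^{-(t+1)}} when Σ_j |(G_t)_{ij}| d_j/d_i > 0, and (R_t)_{ii} = 0 otherwise. Let φ: ℝ^q → ℝ^q act componentwise, φ(z)_i = φ_i(z_i), where each φ_i: ℝ → ℝ is nondecreasing and 1-Lipschitz. Then the residual map f: ℝ^p → ℝ^p defined by f(x) = x − 2 W R_t² φ(Wᵀ x + b) is 1-Lipschitz for the ℓ₂ norms: ‖f(x) − f(y)‖₂ ≤ ‖x − y‖₂ for all x, y ∈ ℝ^p. -/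
open Matrix

lemma aux_step {q : ℕ} (A : Matrix (Fin q) (Fin q) ℝ) (hA : A.IsHermitian) (r : Fin q → ℝ)
    (hr : ∀ i, 0 ≤ r i)
    (h : ∀ x : Fin q → ℝ, x ⬝ᵥ ((A * A) *ᵥ x) ≤ ∑ i, (r i) ^ 2 * (x i) ^ 2) :
    ∀ x : Fin q → ℝ, x ⬝ᵥ (A *ᵥ x) ≤ ∑ i, r i * (x i) ^ 2 := by
  have hH : (Matrix.diagonal r - A).IsHermitian :=
    (Matrix.isHermitian_diagonal r).sub hA
  have hP : (Matrix.diagonal r - A).PosSemidef := by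
    rw [hH.posSemidef_iff_eigenvalues_nonneg]
    intro k
    by_contra hk
    simp only [Pi.zero_apply, not_le] at hk
    set ν := hH.eigenvalues k with hν
    have he := hH.mulVec_eigenvectorBasis k
    set v : Fin q → ℝ := ⇑(hH.eigenvectorBasis k) with hv
    have hv0 : 0 < ∑ i, (v i) ^ 2 := by
      have h1 : ‖hH.eigenvectorBasis k‖ = 1 := hH.eigenvectorBasis.orthonormal.1 k
      rw [EuclideanSpace.norm_eq, Real.sqrt_eq_one] at h1
      simp only [Real.norm_eq_abs, sq_abs] at h1
      rw [hv, h1]; norm_num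
    have hAv : ∀ i, (A *ᵥ v) i = r i * v i - ν * v i := by
      intro i
      have := congrFun he i
      rw [Matrix.sub_mulVec] at this
      simp only [Pi.sub_apply, Matrix.mulVec_diagonal, Pi.smul_apply, smul_eq_mul] at this
      linarith
    have hAt : Aᵀ = A := by simpa [Matrix.IsHermitian] using hA
    have h2 : v ⬝ᵥ ((A * A) *ᵥ v) = ∑ i, ((A *ᵥ v) i) ^ 2 := by
      rw [← Matrix.mulVec_mulVec, Matrix.dotProduct_mulVec, ← Matrix.mulVec_transpose, hAt]
      simp [dotProduct, sq]
    have h3 := h v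
    rw [h2] at h3
    have h4 : ∑ i, (r i) ^ 2 * (v i) ^ 2 + ν ^ 2 * ∑ i, (v i) ^ 2 ≤ ∑ i, ((A *ᵥ v) i) ^ 2 := by
      rw [Finset.mul_sum, ← Finset.sum_add_distrib]
      apply Finset.sum_le_sum
      intro i _
      rw [hAv]
      nlinarith [mul_nonneg (mul_nonneg (hr i) (neg_nonneg.2 hk.le)) (sq_nonneg (v i))]
    have : 0 < ν ^ 2 * ∑ i, (v i) ^ 2 := mul_pos (sq_pos_of_neg hk) hv0
    linarith
  intro x
  have := hP.dotProduct_mulVec_nonneg x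
  rw [Matrix.sub_mulVec, dotProduct_sub] at this
  have h5 : x ⬝ᵥ (Matrix.diagonal r *ᵥ x) = ∑ i, r i * (x i) ^ 2 := by
    simp only [dotProduct, Matrix.mulVec_diagonal]
    exact Finset.sum_congr rfl fun i _ => by ring
  simp only [star_trivial] at this
  linarith

lemma aux_iter {q : ℕ} (A : Matrix (Fin q) (Fin q) ℝ) (hA : A.IsHermitian) (r : Fin q → ℝ)
    (hr : ∀ i, 0 ≤ r i) (t : ℕ)
    (h : ∀ x : Fin q → ℝ, x ⬝ᵥ ((A ^ (2 ^ t)) *ᵥ x) ≤ ∑ i, (r i) ^ (2 ^ t) * (x i) ^ 2) :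
    ∀ x : Fin q → ℝ, x ⬝ᵥ (A *ᵥ x) ≤ ∑ i, r i * (x i) ^ 2 := by
  induction t with
  | zero => simpa using h
  | succ t ih =>
    apply ih
    apply aux_step _ (hA.pow _) _ (fun i => pow_nonneg (hr i) _)
    intro x
    have := h x
    simpa only [pow_succ 2 t, pow_mul, sq (A ^ 2 ^ t)] using this

lemma aux_dom {q : ℕ} (G : Matrix (Fin q) (Fin q) ℝ) (hG : Gᵀ = G) (d : Fin q → ℝ)
    (hd : ∀ i, 0 < d i) (x : Fin q → ℝ) :
    x ⬝ᵥ (G *ᵥ x) ≤ ∑ i, (∑ j, |G i j| * d j / d i) * (x i) ^ 2 := by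
  have hs : ∀ i j, G j i = G i j := fun i j => congrFun (congrFun hG i) j
  have h1 : x ⬝ᵥ (G *ᵥ x) = ∑ i, ∑ j, G i j * x i * x j := by
    simp only [dotProduct, Matrix.mulVec, Finset.mul_sum]
    exact Finset.sum_congr rfl fun i _ => Finset.sum_congr rfl fun j _ => by ring
  have h2 : ∑ i, (∑ j, |G i j| * d j / d i) * (x i) ^ 2
      = ∑ i, ∑ j, |G i j| * d j / d i * (x i) ^ 2 := by
    simp only [Finset.sum_mul]
  have h3 : ∑ i, ∑ j, |G i j| * d j / d i * (x i) ^ 2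
      = ∑ i, ∑ j, |G i j| * d i / d j * (x j) ^ 2 := by
    rw [Finset.sum_comm]
    exact Finset.sum_congr rfl fun i _ => Finset.sum_congr rfl fun j _ => by rw [hs]
  have h4 : 2 * ∑ i, ∑ j, G i j * x i * x j ≤ ∑ i, ∑ j, |G i j| * d j / d i * (x i) ^ 2
      + ∑ i, ∑ j, |G i j| * d i / d j * (x j) ^ 2 := by
    simp only [Finset.mul_sum, ← Finset.sum_add_distrib]
    refine Finset.sum_le_sum fun i _ => Finset.sum_le_sum fun j _ => ?_
    have hi := hd i
    have hj := hd j
    have e : |G i j| * d j / d i * x i ^ 2 + |G i j| * d i / d j * x j ^ 2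
        = 2 * (|G i j| * (|x i| * |x j|))
          + |G i j| * ((d j * |x i| - d i * |x j|) ^ 2 / (d i * d j)) := by
      rw [← sq_abs (x i), ← sq_abs (x j)]
      field_simp
      ring
    rw [e]
    have a1 : 0 ≤ |G i j| * ((d j * |x i| - d i * |x j|) ^ 2 / (d i * d j)) := by positivity
    have a2 : G i j * x i * x j ≤ |G i j| * (|x i| * |x j|) := by
      rw [← abs_mul, ← abs_mul, ← mul_assoc]; exact le_abs_self _
    linarith
  rw [h1, h2]
  linarith

lemma aux_scal (s : ℝ) (hs : 0 ≤ s) (t : ℕ) (c : ℝ)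
    (hc : c = if 0 < s then s ^ (-((2:ℝ) ^ (-((t:ℝ) + 1)))) else (0:ℝ)) :
    (s ^ (((2 ^ t : ℕ) : ℝ)⁻¹)) * (c * c) ^ 2 = c * c := by
  split_ifs at hc with h
  · have h1 : c * c = s ^ (-(((2 ^ t : ℕ) : ℝ)⁻¹)) := by
      rw [hc, ← Real.rpow_add h]
      congr 1
      rw [Real.rpow_neg (by norm_num), Real.rpow_add (by norm_num), Real.rpow_natCast]
      push_cast
      rw [Real.rpow_one]
      field_simp
      norm_num
    rw [h1, sq, ← mul_assoc, ← Real.rpow_add h]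
    simp
  · simp [hc]

lemma aux_act (g : ℝ → ℝ) (hm : Monotone g) (hl : LipschitzWith 1 g) (a b : ℝ) :
    (g a - g b) ^ 2 ≤ (g a - g b) * (a - b) := by
  have h := hl.dist_le_mul a b
  simp only [Real.dist_eq, NNReal.coe_one, one_mul] at h
  rcases le_total a b with hab | hab
  · have := hm hab
    rw [abs_of_nonpos (by linarith), abs_of_nonpos (by linarith)] at h
    nlinarith
  · have := hm hab
    rw [abs_of_nonneg (by linarith), abs_of_nonneg (by linarith)] at h
    nlinarith

/-- The residual layer `x ↦ x − 2 W R_t² φ(Wᵀ x + b)` built from the weighted spectral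
rescaling `R_t` and componentwise nondecreasing `1`-Lipschitz activations `φ` is
`1`-Lipschitz for the ℓ₂ norms. -/
theorem weighted_spectral_rescaling_residual_layer_one_lipschitz
    (p q : ℕ) (W : Matrix (Fin p) (Fin q) ℝ) (b : Fin q → ℝ)
    (d : Fin q → ℝ) (hd : ∀ i, 0 < d i)
    (t : ℕ)
    (G : Matrix (Fin q) (Fin q) ℝ) (hG : G = (Wᵀ * W) ^ (2 ^ t))
    (R : Matrix (Fin q) (Fin q) ℝ)
    (hR : R = Matrix.diagonal (fun i : Fin q =>
      if 0 < ∑ j : Fin q, |G i j| * d j / d i then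
        (∑ j : Fin q, |G i j| * d j / d i) ^ (-((2:ℝ) ^ (-((t:ℝ) + 1))))
      else (0:ℝ)))
    (φ : Fin q → ℝ → ℝ)
    (hφ_mono : ∀ i, Monotone (φ i))
    (hφ_lip : ∀ i, LipschitzWith 1 (φ i))
    (f : (Fin p → ℝ) → (Fin p → ℝ))
    (hf : ∀ x : Fin p → ℝ,
      f x = x - (2:ℝ) • (W * (R * R)).mulVec (fun i => φ i ((Wᵀ.mulVec x + b) i))) :
    ∀ x y : Fin p → ℝ, l2norm (f x - f y) ≤ l2norm (x - y) := by
  intro x y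
  unfold l2norm
  apply Real.sqrt_le_sqrt
  set s : Fin q → ℝ := fun i => ∑ j : Fin q, |G i j| * d j / d i with hs
  have hs0 : ∀ i, 0 ≤ s i := fun i => Finset.sum_nonneg fun j _ =>
    div_nonneg (mul_nonneg (abs_nonneg _) (hd j).le) (hd i).le
  set c : Fin q → ℝ := fun i =>
    if 0 < s i then (s i) ^ (-((2:ℝ) ^ (-((t:ℝ) + 1)))) else (0:ℝ) with hc
  set r : Fin q → ℝ := fun i => (s i) ^ (((2 ^ t : ℕ) : ℝ)⁻¹) with hr
  have hRc : R = Matrix.diagonal c := hR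
  have hrc : ∀ i, r i * (c i * c i) ^ 2 = c i * c i := fun i => aux_scal (s i) (hs0 i) t (c i) rfl
  have hr0 : ∀ i, 0 ≤ r i := fun i => Real.rpow_nonneg (hs0 i) _
  have hrp : ∀ i, (r i) ^ (2 ^ t) = s i := fun i =>
    Real.rpow_inv_natCast_pow (hs0 i) (by positivity)
  have hMH : (Wᵀ * W).IsHermitian := by
    simpa using Matrix.isHermitian_conjTranspose_mul_self W
  have hGT : Gᵀ = G := by
    have := hMH.pow (2 ^ t)
    rw [hG]; simpa [Matrix.IsHermitian] using this
  have hM := aux_iter (Wᵀ * W) hMH r hr0 t (by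
    intro z
    rw [← hG]
    simp only [hrp]
    exact aux_dom G hGT d hd z)
  set u : Fin q → ℝ := fun i => φ i ((Wᵀ.mulVec x + b) i) - φ i ((Wᵀ.mulVec y + b) i) with hu
  set w : Fin q → ℝ := fun i => c i * c i * u i with hw
  have hdiff : f x - f y = (x - y) - (2:ℝ) • (W *ᵥ w) := by
    have e : W *ᵥ w = (W * (R * R)) *ᵥ u := by
      rw [← Matrix.mulVec_mulVec, hRc, Matrix.diagonal_mul_diagonal]
      congr 1
      ext i
      rw [Matrix.mulVec_diagonal]
    have e2 : u = (fun i => φ i ((Wᵀ.mulVec x + b) i)) - (fun i => φ i ((Wᵀ.mulVec y + b) i)) := rfl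
    rw [hf, hf, e, e2, Matrix.mulVec_sub, smul_sub]
    abel
  have hsq : ∑ i, ((f x - f y) i) ^ 2 = ∑ i, ((x - y) i) ^ 2
      - 4 * (w ⬝ᵥ (Wᵀ *ᵥ (x - y))) + 4 * (w ⬝ᵥ ((Wᵀ * W) *ᵥ w)) := by
    have e1 : w ⬝ᵥ (Wᵀ *ᵥ (x - y)) = ∑ i, (W *ᵥ w) i * (x - y) i := by
      rw [Matrix.dotProduct_mulVec, Matrix.vecMul_transpose]; rfl
    have e2 : w ⬝ᵥ ((Wᵀ * W) *ᵥ w) = ∑ i, (W *ᵥ w) i * (W *ᵥ w) i := by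
      rw [← Matrix.mulVec_mulVec, Matrix.dotProduct_mulVec, Matrix.vecMul_transpose]; rfl
    rw [e1, e2, hdiff, Finset.mul_sum, Finset.mul_sum, ← Finset.sum_sub_distrib,
      ← Finset.sum_add_distrib]
    refine Finset.sum_congr rfl fun i _ => ?_
    simp only [Pi.sub_apply, Pi.smul_apply, smul_eq_mul]
    ring
  have hb : w ⬝ᵥ ((Wᵀ * W) *ᵥ w) ≤ w ⬝ᵥ (Wᵀ *ᵥ (x - y)) := by
    refine (hM w).trans ?_
    unfold dotProduct
    refine Finset.sum_le_sum fun i _ => ?_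
    have h1 := aux_act (φ i) (hφ_mono i) (hφ_lip i) ((Wᵀ.mulVec x + b) i) ((Wᵀ.mulVec y + b) i)
    have h2 : (Wᵀ *ᵥ (x - y)) i = (Wᵀ.mulVec x + b) i - (Wᵀ.mulVec y + b) i := by
      rw [Matrix.mulVec_sub]; simp
    have h3 : r i * (w i) ^ 2 = c i * c i * (u i) ^ 2 := by
      rw [← hrc i]
      simp only [hw, mul_pow]
      ring
    rw [h2, h3]
    have := mul_le_mul_of_nonneg_left h1 (mul_self_nonneg (c i))
    calc _ ≤ _ := this
      _ = _ := by simp only [hw, hu]; ring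
  rw [hsq]
  linarith
end
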